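/- Let α ∈ (0, 1/2) and f(z) = ((z−1)/(z+1))^α, taking the branch holomorphic on ℂ \ [−1, 1] with f(∞) = 1, and for each n let Q_{n,0}, Q_{n,1}, Q_{n,2} be Hermite–Padé polynomials of order n for (1, f, f^2). Then for each j = 0, 1, 2, the normalized zero-counting measures (1/n) ∑_{ζ : Q_{n,j}(ζ) = 0} δ_ζ (zeros counted with multiplicity) converge weakly, as n → ∞, to the probability measure on ℝ \ [−1, 1] with density ρ(x) = (√3 / (2π)) · (x^2 − 1)^{−1/3} · ((|x| − 1)^{−1/3} − (|x| + 1)^{−1/3}) for |x| > 1. -/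

import Mathlib

open MeasureTheory
open scoped ENNReal

/-- The limiting zero-distribution density
`ρ(x) = (√3/(2π)) (x²−1)^{−1/3} ((|x|−1)^{−1/3} − (|x|+1)^{−1/3})`, `|x| > 1`. -/
noncomputable def limitDensity (x : ℝ) : ℝ :=
  (Real.sqrt 3 / (2 * Real.pi)) * (x ^ 2 - 1) ^ (-(1 : ℝ) / 3) *
    ((|x| - 1) ^ (-(1 : ℝ) / 3) - (|x| + 1) ^ (-(1 : ℝ) / 3))

/-- The normalized zero-counting measure `(1/n) ∑_{ζ : Q(ζ)=0} δ_ζ` (zeros counted with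
multiplicity) of a polynomial `Q` over `ℂ`. -/
noncomputable def zeroCountingMeasure (n : ℕ) (Q : Polynomial ℂ) : Measure ℂ :=
  ((n : ℝ≥0∞))⁻¹ • (Q.roots.map Measure.dirac).sum

open Polynomial in
/-- A sequence of positive coefficients whose polynomial has only real zeros keeps this property
when multiplied by a nonconstant affine function of the index. -/
theorem realRooted_affine_mul {n : ℕ} (hn : 0 < n) {c : ℕ → ℝ} (hc : ∀ k ≤ n, 0 < c k)
    (h : ∀ z : ℂ, z.im ≠ 0 → ∑ k ∈ Finset.range (n + 1), (c k : ℂ) * z ^ k ≠ 0)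
    (a b : ℝ) (hb : b ≠ 0) (z : ℂ) (hz : z.im ≠ 0) :
    ∑ k ∈ Finset.range (n + 1), (((a + b * k) * c k : ℝ) : ℂ) * z ^ k ≠ 0 := by
  set p : ℂ[X] := ∑ k ∈ Finset.range (n + 1), C (c k : ℂ) * X ^ k with hp
  have hev : ∀ w : ℂ, p.eval w = ∑ k ∈ Finset.range (n + 1), (c k : ℂ) * w ^ k := by
    intro w; simp [hp, eval_finsetSum]
  have hcoef : p.coeff n = c n := by
    simp [hp, coeff_C_mul, coeff_X_pow]
  have hp0 : p ≠ 0 := by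
    intro h0
    rw [h0] at hcoef
    have := hc n le_rfl
    simp at hcoef
    exact this.ne (by exact_mod_cast hcoef)
  have hdeg : 0 < p.natDegree := lt_of_lt_of_le hn (le_natDegree_of_ne_zero (by
    rw [hcoef]; exact_mod_cast (hc n le_rfl).ne'))
  have hsp : p.Splits := IsAlgClosed.splits p
  have hroots : ∀ x ∈ p.roots, x.im = 0 ∧ x.re < 0 := by
    intro x hx
    have hx0 := (mem_roots hp0).1 hx
    rw [IsRoot, hev] at hx0
    have him : x.im = 0 := by
      by_contra hi
      exact h x hi hx0
    refine ⟨him, ?_⟩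
    by_contra hre
    push Not at hre
    have hxr : x = (x.re : ℂ) := by apply Complex.ext <;> simp [him]
    rw [hxr] at hx0
    have h2 : ∑ k ∈ Finset.range (n + 1), c k * x.re ^ k = 0 := by exact_mod_cast hx0
    have h3 : 0 < ∑ k ∈ Finset.range (n + 1), c k * x.re ^ k := by
      apply Finset.sum_pos'
      · intro k hk
        have := hc k (by simpa [Nat.lt_succ_iff] using hk)
        positivity
      · exact ⟨0, by simp, by simpa using hc 0 (Nat.zero_le n)⟩
    linarith
  have hpz : p.eval z ≠ 0 := by rw [hev]; exact h z hz
  have hq : ∑ k ∈ Finset.range (n + 1), (((a + b * k) * c k : ℝ) : ℂ) * z ^ k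
      = a * p.eval z + b * (z * p.derivative.eval z) := by
    rw [hev, hp, derivative_sum, eval_finsetSum, Finset.mul_sum, Finset.mul_sum, Finset.mul_sum,
      ← Finset.sum_add_distrib]
    refine Finset.sum_congr rfl fun k _ => ?_
    rcases k with _ | k
    · simp
    · rw [derivative_C_mul_X_pow]
      simp only [eval_mul, eval_C, eval_pow, eval_X, Nat.add_sub_cancel]
      push_cast
      ring
  rw [hq]
  intro h0
  have hlog := hsp.eval_derivative_div_eval_of_ne_zero hpz
  have h1 : (z * (p.derivative.eval z / p.eval z)).im = 0 := by
    have hb' : (b : ℂ) ≠ 0 := by exact_mod_cast hb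
    have : z * (p.derivative.eval z / p.eval z) = ((-a / b : ℝ) : ℂ) := by
      push_cast
      field_simp
      linear_combination h0
    rw [this, Complex.ofReal_im]
  rw [hlog, ← Multiset.sum_map_mul_left] at h1
  have himsum : ∀ s : Multiset ℂ, (s.map fun x => z * (1 / (z - x))).sum.im
      = (s.map fun x => (z * (1 / (z - x))).im).sum := by
    intro s
    induction s using Multiset.induction_on with
    | empty => simp
    | cons a s ih => simp only [Multiset.map_cons, Multiset.sum_cons, Complex.add_im, ih]
  rw [himsum] at h1
  have hterm : ∀ x ∈ p.roots, 0 < z.im * (z * (1 / (z - x))).im := by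
    intro x hx
    obtain ⟨hx1, hx2⟩ := hroots x hx
    have hne : z - x ≠ 0 := by
      intro hh
      have := congrArg Complex.im hh
      simp [hx1] at this
      exact hz this
    have hns : 0 < Complex.normSq (z - x) := Complex.normSq_pos.2 hne
    have : z.im * (z * (1 / (z - x))).im = z.im ^ 2 * (-x.re) / Complex.normSq (z - x) := by
      rw [one_div, Complex.mul_im, Complex.inv_re, Complex.inv_im]
      simp only [Complex.sub_re, Complex.sub_im, hx1]
      field_simp
      ring
    rw [this]
    have : 0 < z.im ^ 2 := by positivity
    have : 0 < -x.re := by linarith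
    positivity
  have hpos : 0 < (p.roots.map fun x => z.im * (z * (1 / (z - x))).im).sum := by
    have hcard : 0 < p.roots.card := by rwa [← hsp.natDegree_eq_card_roots]
    obtain ⟨x, hx⟩ := Multiset.card_pos_iff_exists_mem.1 hcard
    obtain ⟨s, hs⟩ := Multiset.exists_cons_of_mem hx
    rw [hs, Multiset.map_cons, Multiset.sum_cons]
    refine add_pos_of_pos_of_nonneg (hterm x hx) (Multiset.sum_nonneg ?_)
    intro y hy
    obtain ⟨x', hx', rfl⟩ := Multiset.mem_map.1 hy
    exact (hterm x' (by rw [hs]; exact Multiset.mem_cons_of_mem hx')).le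
  rw [Multiset.sum_map_mul_left, h1] at hpos
  simp at hpos

open Polynomial in
/-- A coefficientwise limit of real-rooted polynomials of exact degree `n` is real-rooted. -/
theorem realRooted_of_tendsto {n : ℕ} {c : ℕ → ℝ} {d : ℕ → ℕ → ℝ} (hc : c n ≠ 0)
    (hd : ∀ N, d N n ≠ 0)
    (hlim : ∀ k ≤ n, Filter.Tendsto (fun N => d N k) Filter.atTop (nhds (c k)))
    (h : ∀ N, ∀ z : ℂ, z.im ≠ 0 → ∑ k ∈ Finset.range (n + 1), (d N k : ℂ) * z ^ k ≠ 0)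
    (z : ℂ) (hz : z.im ≠ 0) :
    ∑ k ∈ Finset.range (n + 1), (c k : ℂ) * z ^ k ≠ 0 := by
  have hbound : ∀ N, |d N n| * |z.im| ^ n
      ≤ ‖∑ k ∈ Finset.range (n + 1), (d N k : ℂ) * z ^ k‖ := by
    intro N
    set p : ℂ[X] := ∑ k ∈ Finset.range (n + 1), C (d N k : ℂ) * X ^ k with hp
    have hev : ∀ w : ℂ, p.eval w = ∑ k ∈ Finset.range (n + 1), (d N k : ℂ) * w ^ k := by
      intro w; simp [hp, eval_finsetSum]
    have hcoef : p.coeff n = d N n := by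
      simp [hp, coeff_C_mul, coeff_X_pow]
    have hne : p.coeff n ≠ 0 := by rw [hcoef]; exact_mod_cast hd N
    have hp0 : p ≠ 0 := by
      intro h0
      simp [h0] at hne
    have hdeg : p.natDegree = n := by
      refine le_antisymm ?_ (le_natDegree_of_ne_zero hne)
      refine natDegree_sum_le_of_forall_le _ _ fun k hk => ?_
      exact (natDegree_C_mul_X_pow_le _ _).trans (by simpa [Nat.lt_succ_iff] using hk)
    have hsp : p.Splits := IsAlgClosed.splits p
    rw [← hev, hsp.eval_eq_prod_roots, norm_mul]
    have hl : p.leadingCoeff = d N n := by rw [leadingCoeff, hdeg, hcoef]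
    rw [hl, Complex.norm_real, Real.norm_eq_abs]
    refine mul_le_mul_of_nonneg_left ?_ (abs_nonneg _)
    have hroots : ∀ x ∈ p.roots, |z.im| ≤ ‖z - x‖ := by
      intro x hx
      have hx0 := (mem_roots hp0).1 hx
      rw [IsRoot, hev] at hx0
      have him : x.im = 0 := by
        by_contra hi
        exact h N x hi hx0
      have := Complex.abs_im_le_norm (z - x)
      simpa [him] using this
    have hcard : p.roots.card = n := by rw [← hsp.natDegree_eq_card_roots, hdeg]
    rw [← hcard]
    generalize p.roots = s at hroots
    induction s using Multiset.induction_on with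
    | empty => simp
    | cons a s ih =>
      rw [Multiset.card_cons, Multiset.map_cons, Multiset.prod_cons, norm_mul, pow_succ, mul_comm]
      exact mul_le_mul (hroots a (by simp))
        (ih fun x hx => hroots x (Multiset.mem_cons_of_mem hx)) (by positivity) (by positivity)
  have hl1 : Filter.Tendsto (fun N => |d N n| * |z.im| ^ n) Filter.atTop
      (nhds (|c n| * |z.im| ^ n)) := ((hlim n le_rfl).abs).mul_const _
  have hl2 : Filter.Tendsto (fun N => ‖∑ k ∈ Finset.range (n + 1), (d N k : ℂ) * z ^ k‖)
      Filter.atTop (nhds ‖∑ k ∈ Finset.range (n + 1), (c k : ℂ) * z ^ k‖) := by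
    refine Filter.Tendsto.norm (tendsto_finsetSum _ fun k hk => ?_)
    refine Filter.Tendsto.mul_const _ ?_
    exact (Complex.continuous_ofReal.tendsto _).comp
      (hlim k (by simpa [Nat.lt_succ_iff] using hk))
  have := le_of_tendsto_of_tendsto' hl1 hl2 hbound
  intro h0
  rw [h0, norm_zero] at this
  have : 0 < |c n| * |z.im| ^ n := by positivity
  linarith

/-- The rising factorial `(1 + d)_k`. -/
noncomputable def shiftedPoch (d : ℝ) (k : ℕ) : ℝ := ∏ i ∈ Finset.range k, (d + 1 + i)

theorem shiftedPoch_pos {d : ℝ} (hd : -1 < d) (k : ℕ) : 0 < shiftedPoch d k :=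
  Finset.prod_pos fun i _ => by
    have : (0 : ℝ) ≤ i := Nat.cast_nonneg i
    linarith

/-- The coefficient multipliers `1 / ((1 + d)_k (1 - d)_{n - k})`. -/
noncomputable def hpWeight (d : ℝ) (n k : ℕ) : ℝ := (shiftedPoch d k * shiftedPoch (-d) (n - k))⁻¹

theorem hpWeight_pos {d : ℝ} (hd : |d| < 1) (n k : ℕ) : 0 < hpWeight d n k := by
  obtain ⟨h1, h2⟩ := abs_lt.1 hd
  exact inv_pos.2 (mul_pos (shiftedPoch_pos h1 _) (shiftedPoch_pos (by linarith) _))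

theorem tendsto_shiftedPoch_ratio {d : ℝ} (hd : -1 < d) (k : ℕ) :
    Filter.Tendsto (fun N : ℕ => (∏ j ∈ Finset.range N, (d + 1 + k + j)) /
      (shiftedPoch d N * (N : ℝ) ^ k)) Filter.atTop (nhds (shiftedPoch d k)⁻¹) := by
  have hterm : ∀ i : ℕ, Filter.Tendsto (fun N : ℕ => (d + 1 + N + i) / (N : ℝ)) Filter.atTop
      (nhds 1) := by
    intro i
    have h1 : Filter.Tendsto (fun N : ℕ => (d + 1 + i) / (N : ℝ) + 1) Filter.atTop
        (nhds (0 + 1)) :=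
      (tendsto_const_div_atTop_nhds_zero_nat (d + 1 + i)).add_const 1
    rw [zero_add] at h1
    refine h1.congr' ?_
    filter_upwards [Filter.eventually_gt_atTop 0] with N hN
    have : (N : ℝ) ≠ 0 := by exact_mod_cast hN.ne'
    field_simp
    ring
  have hprod : Filter.Tendsto (fun N : ℕ => (∏ i ∈ Finset.range k, (d + 1 + N + i) / (N : ℝ)) *
      (shiftedPoch d k)⁻¹) Filter.atTop (nhds ((∏ _i ∈ Finset.range k, (1 : ℝ)) *
      (shiftedPoch d k)⁻¹)) :=
    (tendsto_finsetProd _ fun i _ => hterm i).mul_const _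
  rw [Finset.prod_const_one, one_mul] at hprod
  refine hprod.congr' ?_
  filter_upwards [Filter.eventually_gt_atTop 0] with N hN
  have hN' : (N : ℝ) ≠ 0 := by exact_mod_cast hN.ne'
  have hN0 := (shiftedPoch_pos hd N).ne'
  have hk0 := (shiftedPoch_pos hd k).ne'
  rw [Finset.prod_div_distrib, Finset.prod_const, Finset.card_range]
  have e1 : shiftedPoch d (N + k) = shiftedPoch d N * ∏ i ∈ Finset.range k, (d + 1 + N + i) := by
    rw [shiftedPoch, Finset.prod_range_add, shiftedPoch]
    congr 1
    refine Finset.prod_congr rfl fun i _ => ?_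
    push_cast; ring
  have e2 : shiftedPoch d (N + k) = shiftedPoch d k * ∏ i ∈ Finset.range N, (d + 1 + k + i) := by
    rw [add_comm N k, shiftedPoch, Finset.prod_range_add, shiftedPoch]
    congr 1
    refine Finset.prod_congr rfl fun i _ => ?_
    push_cast; ring
  have e3 := e1.symm.trans e2
  field_simp
  linear_combination e3

/-- The multipliers `hpWeight` preserve real-rootedness of polynomials with positive
coefficients. -/
theorem realRooted_hpWeight {n : ℕ} (hn : 0 < n) {c : ℕ → ℝ} (hc : ∀ k ≤ n, 0 < c k)
    (h : ∀ z : ℂ, z.im ≠ 0 → ∑ k ∈ Finset.range (n + 1), (c k : ℂ) * z ^ k ≠ 0)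
    {d : ℝ} (hd : |d| < 1) (z : ℂ) (hz : z.im ≠ 0) :
    ∑ k ∈ Finset.range (n + 1), ((hpWeight d n k * c k : ℝ) : ℂ) * z ^ k ≠ 0 := by
  obtain ⟨hd1, hd2⟩ := abs_lt.1 hd
  have hfac : ∀ (j k : ℕ), k ≤ n → 0 < d + 1 + k + j ∧ 0 < -d + 1 + (n - k : ℕ) + j := by
    intro j k hk
    have h1 : (0 : ℝ) ≤ k := Nat.cast_nonneg k
    have h2 : (0 : ℝ) ≤ j := Nat.cast_nonneg j
    have h3 : (0 : ℝ) ≤ (n - k : ℕ) := Nat.cast_nonneg _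
    constructor <;> linarith
  have hprod : ∀ N : ℕ, (∀ k ≤ n, 0 < (∏ j ∈ Finset.range N, (d + 1 + k + j)) *
        (∏ j ∈ Finset.range N, (-d + 1 + (n - k : ℕ) + j)) * c k) := by
    intro N k hk
    exact mul_pos (mul_pos (Finset.prod_pos fun j _ => (hfac j k hk).1)
      (Finset.prod_pos fun j _ => (hfac j k hk).2)) (hc k hk)
  have hstep : ∀ N : ℕ, ∀ z : ℂ, z.im ≠ 0 → ∑ k ∈ Finset.range (n + 1),
      (((∏ j ∈ Finset.range N, (d + 1 + k + j)) *
        (∏ j ∈ Finset.range N, (-d + 1 + (n - k : ℕ) + j)) * c k : ℝ) : ℂ) * z ^ k ≠ 0 := by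
    intro N
    induction N with
    | zero => simpa using h
    | succ N ih =>
      have h1 := realRooted_affine_mul hn (hprod N) ih (d + 1 + N) 1 one_ne_zero
      have hpos1 : ∀ k ≤ n, 0 < (d + 1 + N + 1 * k) * ((∏ j ∈ Finset.range N, (d + 1 + k + j)) *
          (∏ j ∈ Finset.range N, (-d + 1 + (n - k : ℕ) + j)) * c k) := by
        intro k hk
        refine mul_pos ?_ (hprod N k hk)
        have := (hfac N k hk).1
        linarith
      have h2 := realRooted_affine_mul hn hpos1 h1 (-d + 1 + n + N) (-1) (by norm_num)
      intro w hw
      have h3 := h2 w hw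
      convert h3 using 1
      refine Finset.sum_congr rfl fun k hk => ?_
      have hk' : k ≤ n := by simpa [Nat.lt_succ_iff] using hk
      rw [Finset.prod_range_succ, Finset.prod_range_succ, Nat.cast_sub hk']
      push_cast
      ring
  refine realRooted_of_tendsto (c := fun k => hpWeight d n k * c k)
    (d := fun N k => ((∏ j ∈ Finset.range (N + 1), (d + 1 + k + j)) *
        (∏ j ∈ Finset.range (N + 1), (-d + 1 + (n - k : ℕ) + j)) * c k) *
        (shiftedPoch d (N + 1) * shiftedPoch (-d) (N + 1) * ((N + 1 : ℕ) : ℝ) ^ n)⁻¹)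
    (mul_pos (hpWeight_pos hd n n) (hc n le_rfl)).ne' ?_ ?_ ?_ z hz
  · intro N
    have h1 := shiftedPoch_pos hd1 (N + 1)
    have h2 := shiftedPoch_pos (d := -d) (by linarith) (N + 1)
    have h3 : (0 : ℝ) < ((N + 1 : ℕ) : ℝ) := by positivity
    exact (mul_pos (hprod (N + 1) n le_rfl) (inv_pos.2 (by positivity))).ne'
  · intro k hk
    have h1 := tendsto_shiftedPoch_ratio hd1 k
    have h2 := tendsto_shiftedPoch_ratio (d := -d) (by linarith) (n - k)
    have h3 := ((h1.mul h2).mul_const (c k)).comp (Filter.tendsto_add_atTop_nat 1)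
    rw [hpWeight, mul_inv]
    refine h3.congr fun N => ?_
    have e : ((N + 1 : ℕ) : ℝ) ^ n = ((N + 1 : ℕ) : ℝ) ^ k * ((N + 1 : ℕ) : ℝ) ^ (n - k) := by
      rw [← pow_add, Nat.add_sub_cancel' hk]
    simp only [Function.comp_apply]
    rw [e, div_eq_mul_inv, div_eq_mul_inv, mul_inv, mul_inv, mul_inv, mul_inv]
    ring
  · intro N w hw h0
    refine hstep (N + 1) w hw ?_
    have hne : ((shiftedPoch d (N + 1) * shiftedPoch (-d) (N + 1) *
        ((N + 1 : ℕ) : ℝ) ^ n)⁻¹ : ℝ) ≠ 0 := by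
      have h1 := shiftedPoch_pos hd1 (N + 1)
      have h2 := shiftedPoch_pos (d := -d) (by linarith) (N + 1)
      have h3 : (0 : ℝ) < ((N + 1 : ℕ) : ℝ) := by positivity
      exact (inv_pos.2 (by positivity)).ne'
    have hne' : (((shiftedPoch d (N + 1) * shiftedPoch (-d) (N + 1) *
        ((N + 1 : ℕ) : ℝ) ^ n)⁻¹ : ℝ) : ℂ) ≠ 0 := by exact_mod_cast hne
    refine mul_right_cancel₀ hne' ?_
    rw [zero_mul, ← h0, Finset.sum_mul]
    refine Finset.sum_congr rfl fun k _ => ?_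
    rw [Complex.ofReal_mul (_ * c k)]
    ring

/-- The (unsigned) coefficients of the Hermite–Padé polynomials in the variable
`(z - 1) / (z + 1)`. -/
noncomputable def hpCoeff (d e : ℝ) (n k : ℕ) : ℝ :=
  hpWeight e n k * (hpWeight d n k * n.choose k)

theorem hpCoeff_pos {d e : ℝ} (hd : |d| < 1) (he : |e| < 1) {n k : ℕ} (hk : k ≤ n) :
    0 < hpCoeff d e n k :=
  mul_pos (hpWeight_pos he n k) (mul_pos (hpWeight_pos hd n k)
    (by exact_mod_cast Nat.choose_pos hk))

theorem realRooted_hpCoeff {d e : ℝ} (hd : |d| < 1) (he : |e| < 1) {n : ℕ} (hn : 0 < n)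
    (z : ℂ) (hz : z.im ≠ 0) :
    ∑ k ∈ Finset.range (n + 1), (hpCoeff d e n k : ℂ) * z ^ k ≠ 0 := by
  have hb : ∀ z : ℂ, z.im ≠ 0 →
      ∑ k ∈ Finset.range (n + 1), ((n.choose k : ℝ) : ℂ) * z ^ k ≠ 0 := by
    intro z hz
    have : ∑ k ∈ Finset.range (n + 1), ((n.choose k : ℝ) : ℂ) * z ^ k = (z + 1) ^ n := by
      rw [add_pow]
      refine Finset.sum_congr rfl fun k _ => ?_
      push_cast
      ring
    rw [this]
    refine pow_ne_zero _ fun h => hz ?_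
    simpa using congrArg Complex.im h
  have hpos : ∀ k ≤ n, (0 : ℝ) < n.choose k := fun k hk => by exact_mod_cast Nat.choose_pos hk
  exact realRooted_hpWeight hn (fun k hk => mul_pos (hpWeight_pos hd n k) (hpos k hk))
    (realRooted_hpWeight hn hpos hb hd) he z hz

theorem shiftedPoch_le {d : ℝ} (hd : |d| < 1) (k : ℕ) :
    shiftedPoch d k ≤ (k + 1) * k.factorial := by
  obtain ⟨h1, h2⟩ := abs_lt.1 hd
  induction k with
  | zero => simp [shiftedPoch]
  | succ k ih =>
    rw [shiftedPoch, Finset.prod_range_succ, ← shiftedPoch, Nat.factorial_succ]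
    push_cast
    have hk : (0 : ℝ) ≤ k := Nat.cast_nonneg k
    have hp := (shiftedPoch_pos h1 k).le
    calc shiftedPoch d k * (d + 1 + k) ≤ ((k + 1) * k.factorial) * (k + 1 + 1) :=
          mul_le_mul ih (by linarith) (by linarith) (by positivity)
      _ = _ := by ring

theorem factorial_le_shiftedPoch {d : ℝ} (hd : |d| < 1) (k : ℕ) :
    (k.factorial : ℝ) ≤ ((1 + d)⁻¹ + 1) * (k + 1) * shiftedPoch d k := by
  obtain ⟨h1, h2⟩ := abs_lt.1 hd
  have hd0 : 0 < 1 + d := by linarith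
  have key : ∀ k : ℕ, ((k + 1).factorial : ℝ) ≤ (1 + d)⁻¹ * (k + 1) * shiftedPoch d (k + 1) := by
    intro k
    induction k with
    | zero =>
      have : (1 + d)⁻¹ * (d + 1) = 1 := by field_simp; ring
      simp [shiftedPoch, this]
    | succ k ih =>
      rw [shiftedPoch, Finset.prod_range_succ, ← shiftedPoch, Nat.factorial_succ]
      push_cast
      have hk : (0 : ℝ) ≤ k := Nat.cast_nonneg k
      have hp := shiftedPoch_pos h1 (k + 1)
      have hi : 0 < (1 + d)⁻¹ := inv_pos.2 hd0
      calc ((k : ℝ) + 1 + 1) * (k + 1).factorial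
          ≤ (k + 1 + 1) * ((1 + d)⁻¹ * (k + 1) * shiftedPoch d (k + 1)) :=
            mul_le_mul_of_nonneg_left ih (by positivity)
        _ ≤ (k + 1 + 1) * ((1 + d)⁻¹ * (d + 1 + (k + 1)) * shiftedPoch d (k + 1)) := by
            have : (k : ℝ) + 1 ≤ d + 1 + (k + 1) := by linarith
            gcongr ?_ * (?_ * ?_ * ?_)
        _ = _ := by ring
  rcases k with _ | k
  · simp [shiftedPoch, hd0.le]
  · have hp := shiftedPoch_pos h1 (k + 1)
    have hi : 0 < (1 + d)⁻¹ := inv_pos.2 hd0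
    refine (key k).trans ?_
    push_cast
    gcongr
    · linarith
    · linarith

theorem hpWeight_bounds {d : ℝ} (hd : |d| < 1) : ∃ K : ℝ, 1 ≤ K ∧ ∀ n k : ℕ, k ≤ n →
    n.choose k ≤ K * (n + 1) ^ 2 * (n.factorial * hpWeight d n k) ∧
    n.factorial * hpWeight d n k ≤ K * (n + 1) ^ 2 * n.choose k := by
  obtain ⟨h1, h2⟩ := abs_lt.1 hd
  have hd' : |-d| < 1 := by rwa [abs_neg]
  have hi : 0 < (1 + d)⁻¹ := inv_pos.2 (by linarith)
  have hi' : 0 < (1 + -d)⁻¹ := inv_pos.2 (by linarith)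
  refine ⟨((1 + d)⁻¹ + 1) * ((1 + -d)⁻¹ + 1), by nlinarith, fun n k hk => ?_⟩
  have hp := shiftedPoch_pos h1 k
  have hq := shiftedPoch_pos (d := -d) (by linarith) (n - k)
  have hkn : (k : ℝ) ≤ n := by exact_mod_cast hk
  have hkn' : ((n - k : ℕ) : ℝ) ≤ n := by exact_mod_cast Nat.sub_le n k
  have hn0 : (0 : ℝ) ≤ n := Nat.cast_nonneg n
  have hf : (0 : ℝ) < n.factorial := by exact_mod_cast Nat.factorial_pos n
  have hf1 : (0 : ℝ) < k.factorial := by exact_mod_cast Nat.factorial_pos k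
  have hf2 : (0 : ℝ) < (n - k).factorial := by exact_mod_cast Nat.factorial_pos _
  have hch : (n.choose k : ℝ) = n.factorial / (k.factorial * (n - k).factorial) :=
    Nat.cast_choose ℝ hk
  have e : (n.factorial : ℝ) * hpWeight d n k
      = n.factorial / (shiftedPoch d k * shiftedPoch (-d) (n - k)) := by
    rw [hpWeight, div_eq_mul_inv]
  rw [hch, e]
  constructor
  · rw [div_le_iff₀ (by positivity), mul_div_assoc', div_mul_eq_mul_div, le_div_iff₀ (by positivity)]
    have hA : shiftedPoch d k * shiftedPoch (-d) (n - k)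
        ≤ ((n + 1) * k.factorial) * ((n + 1) * (n - k).factorial) := by
      refine mul_le_mul ((shiftedPoch_le hd k).trans ?_)
        ((shiftedPoch_le hd' (n - k)).trans ?_) hq.le (by positivity) <;> gcongr
    have hK : 1 ≤ ((1 + d)⁻¹ + 1) * ((1 + -d)⁻¹ + 1) := by nlinarith
    calc (n.factorial : ℝ) * (shiftedPoch d k * shiftedPoch (-d) (n - k))
        ≤ n.factorial * (((n + 1) * k.factorial) * ((n + 1) * (n - k).factorial)) := by gcongr
      _ = 1 * ((n + 1) ^ 2 * n.factorial * (k.factorial * (n - k).factorial)) := by ring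
      _ ≤ (((1 + d)⁻¹ + 1) * ((1 + -d)⁻¹ + 1)) *
          ((n + 1) ^ 2 * n.factorial * (k.factorial * (n - k).factorial)) := by gcongr
      _ = _ := by ring
  · rw [div_le_iff₀ (by positivity), mul_div_assoc', div_mul_eq_mul_div, le_div_iff₀ (by positivity)]
    have hA : (k.factorial : ℝ) * (n - k).factorial
        ≤ (((1 + d)⁻¹ + 1) * (n + 1) * shiftedPoch d k) *
          (((1 + -d)⁻¹ + 1) * (n + 1) * shiftedPoch (-d) (n - k)) := by
      refine mul_le_mul ((factorial_le_shiftedPoch hd k).trans ?_)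
        ((factorial_le_shiftedPoch hd' (n - k)).trans ?_) hf2.le (by positivity) <;> gcongr
    calc (n.factorial : ℝ) * (k.factorial * (n - k).factorial)
        ≤ n.factorial * ((((1 + d)⁻¹ + 1) * (n + 1) * shiftedPoch d k) *
          (((1 + -d)⁻¹ + 1) * (n + 1) * shiftedPoch (-d) (n - k))) := by gcongr
      _ = _ := by ring

theorem hpCoeff_bounds {d e : ℝ} (hd : |d| < 1) (he : |e| < 1) : ∃ K : ℝ, 1 ≤ K ∧
    ∀ n k : ℕ, k ≤ n →
    (n.choose k : ℝ) ^ 3 ≤ K * (n + 1) ^ 4 * (n.factorial ^ 2 * hpCoeff d e n k) ∧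
    n.factorial ^ 2 * hpCoeff d e n k ≤ K * (n + 1) ^ 4 * n.choose k ^ 3 := by
  obtain ⟨K, hK, hKb⟩ := hpWeight_bounds hd
  obtain ⟨L, hL, hLb⟩ := hpWeight_bounds he
  refine ⟨K * L, by nlinarith, fun n k hk => ?_⟩
  obtain ⟨a1, a2⟩ := hKb n k hk
  obtain ⟨b1, b2⟩ := hLb n k hk
  have hc : (0 : ℝ) ≤ n.choose k := Nat.cast_nonneg _
  have hwd := hpWeight_pos hd n k
  have hwe := hpWeight_pos he n k
  constructor
  · calc (n.choose k : ℝ) ^ 3 = n.choose k * n.choose k * n.choose k := by ring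
      _ ≤ (K * (n + 1) ^ 2 * (n.factorial * hpWeight d n k)) *
          (L * (n + 1) ^ 2 * (n.factorial * hpWeight e n k)) * n.choose k := by gcongr
      _ = _ := by rw [hpCoeff]; ring
  · calc (n.factorial : ℝ) ^ 2 * hpCoeff d e n k
        = (n.factorial * hpWeight d n k) * (n.factorial * hpWeight e n k) * n.choose k := by
          rw [hpCoeff]; ring
      _ ≤ (K * (n + 1) ^ 2 * n.choose k) * (L * (n + 1) ^ 2 * n.choose k) * n.choose k := by gcongr
      _ = _ := by ring

theorem sum_choose_cube_bounds {σ : ℝ} (hσ : 0 < σ) (n : ℕ) :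
    (1 + σ) ^ (3 * n) ≤
      (n + 1) ^ 2 * ∑ k ∈ Finset.range (n + 1), (n.choose k : ℝ) ^ 3 * (σ ^ 3) ^ k ∧
    ∑ k ∈ Finset.range (n + 1), (n.choose k : ℝ) ^ 3 * (σ ^ 3) ^ k ≤ (1 + σ) ^ (3 * n) := by
  set a : ℕ → ℝ := fun k => n.choose k * σ ^ k with ha
  have ha0 : ∀ k, 0 ≤ a k := fun k => by positivity
  have hs : ∑ k ∈ Finset.range (n + 1), a k = (1 + σ) ^ n := by
    rw [add_comm 1 σ, add_pow]
    refine Finset.sum_congr rfl fun k _ => ?_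
    simp only [ha, one_pow]; ring
  have hc : ∑ k ∈ Finset.range (n + 1), (n.choose k : ℝ) ^ 3 * (σ ^ 3) ^ k
      = ∑ k ∈ Finset.range (n + 1), a k ^ 3 := by
    refine Finset.sum_congr rfl fun k _ => ?_
    simp only [ha]; ring
  have hp : (1 + σ) ^ (3 * n) = (∑ k ∈ Finset.range (n + 1), a k) ^ 3 := by
    rw [hs, ← pow_mul, mul_comm]
  rw [hc, hp]
  constructor
  · have h := pow_sum_div_card_le_sum_pow (s := Finset.range (n + 1)) (f := a)
      (fun k _ => ha0 k) 2
    rw [Finset.card_range, div_le_iff₀ (by positivity), mul_comm] at h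
    exact_mod_cast h
  · have hS : 0 ≤ ∑ k ∈ Finset.range (n + 1), a k := Finset.sum_nonneg fun k _ => ha0 k
    calc ∑ k ∈ Finset.range (n + 1), a k ^ 3
        ≤ ∑ k ∈ Finset.range (n + 1), (∑ k ∈ Finset.range (n + 1), a k) ^ 2 * a k := by
          refine Finset.sum_le_sum fun k hk => ?_
          rw [pow_succ]
          have := Finset.single_le_sum (f := a) (fun i _ => ha0 i) hk
          have := ha0 k
          gcongr
      _ = _ := by rw [← Finset.mul_sum, ← pow_succ]

theorem log_hp_bound {d e : ℝ} (hd : |d| < 1) (he : |e| < 1) : ∃ K : ℝ, 1 ≤ K ∧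
    ∀ (n : ℕ) (σ : ℝ), 0 < σ →
    |Real.log (∑ k ∈ Finset.range (n + 1), hpCoeff d e n k * (σ ^ 3) ^ k) +
      2 * Real.log n.factorial - 3 * n * Real.log (1 + σ)| ≤ Real.log K + 6 * Real.log (n + 1) := by
  obtain ⟨K, hK, hb⟩ := hpCoeff_bounds hd he
  refine ⟨K, hK, fun n σ hσ => ?_⟩
  obtain ⟨c1, c2⟩ := sum_choose_cube_bounds hσ n
  set S := ∑ k ∈ Finset.range (n + 1), hpCoeff d e n k * (σ ^ 3) ^ k with hS
  set T := ∑ k ∈ Finset.range (n + 1), (n.choose k : ℝ) ^ 3 * (σ ^ 3) ^ k with hT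
  have hn0 : (0 : ℝ) ≤ n := Nat.cast_nonneg n
  have hf : (0 : ℝ) < n.factorial := by exact_mod_cast Nat.factorial_pos n
  have hSpos : 0 < S := Finset.sum_pos (fun k hk => mul_pos
    (hpCoeff_pos hd he (by simpa [Nat.lt_succ_iff] using hk)) (by positivity)) ⟨0, by simp⟩
  have d1 : T ≤ K * (n + 1) ^ 4 * (n.factorial ^ 2 * S) := by
    rw [hT, hS, Finset.mul_sum, Finset.mul_sum]
    refine Finset.sum_le_sum fun k hk => ?_
    have := (hb n k (by simpa [Nat.lt_succ_iff] using hk)).1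
    calc _ ≤ K * (n + 1) ^ 4 * (n.factorial ^ 2 * hpCoeff d e n k) * (σ ^ 3) ^ k := by gcongr
      _ = _ := by ring
  have d2 : n.factorial ^ 2 * S ≤ K * (n + 1) ^ 4 * T := by
    rw [hT, hS, Finset.mul_sum, Finset.mul_sum]
    refine Finset.sum_le_sum fun k hk => ?_
    have := (hb n k (by simpa [Nat.lt_succ_iff] using hk)).2
    calc _ = (n.factorial ^ 2 * hpCoeff d e n k) * (σ ^ 3) ^ k := by ring
      _ ≤ K * (n + 1) ^ 4 * n.choose k ^ 3 * (σ ^ 3) ^ k := by gcongr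
      _ = _ := by ring
  have e1 : (1 + σ) ^ (3 * n) ≤ K * (n + 1) ^ 6 * (n.factorial ^ 2 * S) := by
    calc _ ≤ (n + 1) ^ 2 * T := c1
      _ ≤ (n + 1) ^ 2 * (K * (n + 1) ^ 4 * (n.factorial ^ 2 * S)) := by gcongr
      _ = _ := by ring
  have e2 : n.factorial ^ 2 * S ≤ K * (n + 1) ^ 6 * (1 + σ) ^ (3 * n) := by
    have h1 : (1 : ℝ) ≤ (n + 1) := by linarith
    calc _ ≤ K * (n + 1) ^ 4 * T := d2
      _ ≤ K * (n + 1) ^ 6 * (1 + σ) ^ (3 * n) := by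
        gcongr
        norm_num
  have hK0 : 0 < K := by linarith
  have hl : Real.log (n.factorial ^ 2 * S) = Real.log S + 2 * Real.log n.factorial := by
    rw [Real.log_mul (by positivity) hSpos.ne', Real.log_pow]; push_cast; ring
  have hl2 : Real.log ((1 + σ) ^ (3 * n)) = 3 * n * Real.log (1 + σ) := by
    rw [Real.log_pow]; push_cast; ring
  have hl3 : Real.log (K * (n + 1) ^ 6) = Real.log K + 6 * Real.log (n + 1) := by
    rw [Real.log_mul (by positivity) (by positivity), Real.log_pow]; push_cast; ring
  have f1 := Real.log_le_log (by positivity) e1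
  have f2 := Real.log_le_log (by positivity) e2
  rw [Real.log_mul (by positivity) (by positivity), hl, hl2, hl3] at f1
  rw [hl, Real.log_mul (by positivity) (by positivity), hl2, hl3] at f2
  rw [abs_le]
  constructor <;> linarith

theorem tendsto_log_hp {d e : ℝ} (hd : |d| < 1) (he : |e| < 1) {σ : ℝ} (hσ : 0 < σ) :
    Filter.Tendsto (fun n : ℕ => (n : ℝ)⁻¹ *
      (Real.log (∑ k ∈ Finset.range (n + 1), hpCoeff d e n k * (σ ^ 3) ^ k) -
        Real.log (∑ k ∈ Finset.range (n + 1), hpCoeff d e n k))) Filter.atTop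
      (nhds (3 * Real.log ((1 + σ) / 2))) := by
  obtain ⟨K, hK, hb⟩ := log_hp_bound hd he
  have hlim : Filter.Tendsto (fun n : ℕ => 2 * ((Real.log K + 6 * Real.log (n + 1)) / (n : ℝ)))
      Filter.atTop (nhds 0) := by
    have h1 : Filter.Tendsto (fun n : ℕ => Real.log K / (n : ℝ)) Filter.atTop (nhds 0) :=
      tendsto_const_div_atTop_nhds_zero_nat _
    have h2 : Filter.Tendsto (fun n : ℕ => Real.log ((n : ℝ) + 1) / (n : ℝ)) Filter.atTop
        (nhds 0) := by
      have h3 : Filter.Tendsto (fun x : ℝ => Real.log x ^ 1 / (1 * x + -1)) Filter.atTop (nhds 0) :=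
        Real.tendsto_pow_log_div_mul_add_atTop 1 (-1) 1 one_ne_zero
      have h4 : Filter.Tendsto (fun n : ℕ => (n : ℝ) + 1) Filter.atTop Filter.atTop :=
        Filter.tendsto_atTop_add_const_right _ _ tendsto_natCast_atTop_atTop
      refine (h3.comp h4).congr fun n => ?_
      simp
    have h5 := (h1.add (h2.const_mul 6)).const_mul 2
    simp only [mul_zero, add_zero] at h5
    refine h5.congr fun n => ?_
    ring
  rw [tendsto_iff_norm_sub_tendsto_zero]
  refine squeeze_zero' (Filter.Eventually.of_forall fun n => norm_nonneg _) ?_ hlim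
  filter_upwards [Filter.eventually_gt_atTop 0] with n hn
  have hn' : (0 : ℝ) < n := by exact_mod_cast hn
  have b1 := hb n σ hσ
  have b2 := hb n 1 one_pos
  simp only [one_pow, mul_one] at b2
  have hlog : Real.log ((1 + σ) / 2) = Real.log (1 + σ) - Real.log (1 + 1) := by
    rw [Real.log_div (by positivity) (by norm_num)]; norm_num
  rw [hlog, Real.norm_eq_abs]
  set A := Real.log (∑ k ∈ Finset.range (n + 1), hpCoeff d e n k * (σ ^ 3) ^ k)
  set B := Real.log (∑ k ∈ Finset.range (n + 1), hpCoeff d e n k)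
  have key : |A - B - 3 * n * (Real.log (1 + σ) - Real.log (1 + 1))|
      ≤ 2 * (Real.log K + 6 * Real.log (n + 1)) := by
    rw [abs_le] at b1 b2 ⊢
    constructor <;> linarith [b1.1, b1.2, b2.1, b2.2]
  have e : (n : ℝ)⁻¹ * (A - B) - 3 * (Real.log (1 + σ) - Real.log (1 + 1))
      = (A - B - 3 * n * (Real.log (1 + σ) - Real.log (1 + 1))) / n := by
    field_simp
  rw [e, abs_div, abs_of_pos hn', mul_div_assoc']
  gcongr

theorem hasDerivAt_arctan_quadratic (τ : ℝ) :
    HasDerivAt (fun τ => 2 / √3 * Real.arctan ((2 * τ + 1) / √3)) (1 + τ + τ ^ 2)⁻¹ τ := by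
  have h3 : √3 ^ 2 = 3 := Real.sq_sqrt (by norm_num)
  have h30 : √3 ≠ 0 := by positivity
  have hq : 1 + τ + τ ^ 2 ≠ 0 := by nlinarith [sq_nonneg (2 * τ + 1)]
  have h1 : HasDerivAt (fun τ : ℝ => (2 * τ + 1) / √3) (2 * 1 / √3) τ :=
    (((hasDerivAt_id τ).const_mul 2).add_const 1).div_const _
  refine (h1.arctan.const_mul (2 / √3)).congr_deriv ?_
  have hq' : 1 + ((2 * τ + 1) / √3) ^ 2 = 4 / 3 * (1 + τ + τ ^ 2) := by
    rw [div_pow, h3]; ring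
  rw [hq']
  field_simp
  rw [h3]; norm_num

theorem tendsto_arctan_affine {a b c : ℝ} (ha : 0 < a) (hc : 0 < c) :
    Filter.Tendsto (fun τ => Real.arctan ((a * τ + b) / c)) Filter.atTop (nhds (Real.pi / 2)) := by
  have h1 : Filter.Tendsto (fun τ : ℝ => (a * τ + b) / c) Filter.atTop Filter.atTop :=
    (Filter.tendsto_atTop_add_const_right _ _
      (Filter.tendsto_id.const_mul_atTop ha)).atTop_div_const hc
  exact (Real.tendsto_arctan_atTop.mono_right nhdsWithin_le_nhds).comp h1

theorem integral_inv_quadratic :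
    IntegrableOn (fun τ : ℝ => (1 + τ + τ ^ 2)⁻¹) (Set.Ioi 0) ∧
    ∫ τ in Set.Ioi (0 : ℝ), (1 + τ + τ ^ 2)⁻¹ = 2 * Real.pi / (3 * √3) := by
  have hpos : ∀ τ ∈ Set.Ioi (0 : ℝ), 0 ≤ (1 + τ + τ ^ 2)⁻¹ := by
    intro τ hτ
    have : (0 : ℝ) < τ := hτ
    positivity
  have hlim := (tendsto_arctan_affine (a := 2) (b := 1) (c := √3) (by norm_num)
    (by positivity)).const_mul (2 / √3)
  refine ⟨integrableOn_Ioi_deriv_of_nonneg' (fun τ _ => hasDerivAt_arctan_quadratic τ) hpos hlim,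
    ?_⟩
  rw [integral_Ioi_of_hasDerivAt_of_nonneg' (fun τ _ => hasDerivAt_arctan_quadratic τ) hpos hlim]
  rw [mul_zero, zero_add, one_div, Real.arctan_inv_sqrt_three]
  field_simp
  norm_num

theorem quadratic_pos {σ : ℝ} (hσ : 0 < σ) (τ : ℝ) : 0 < τ ^ 2 - σ * τ + σ ^ 2 := by
  nlinarith [sq_nonneg (2 * τ - σ), sq_pos_of_pos hσ]

theorem hasDerivAt_log_cubic {σ τ : ℝ} (hσ : 0 < σ) (hτ : 0 ≤ τ) :
    HasDerivAt (fun τ => Real.log ((τ + σ) ^ 2 / (τ ^ 2 - σ * τ + σ ^ 2)))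
      (2 / (τ + σ) - (2 * τ - σ) / (τ ^ 2 - σ * τ + σ ^ 2)) τ := by
  have hq := quadratic_pos hσ τ
  have hs : 0 < τ + σ := by positivity
  have h1 : HasDerivAt (fun τ : ℝ => (τ + σ) ^ 2) (2 * (τ + σ)) τ := by
    simpa using ((hasDerivAt_id τ).add_const σ).fun_pow 2
  have h2 : HasDerivAt (fun τ : ℝ => τ ^ 2 - σ * τ + σ ^ 2) (2 * τ - σ) τ := by
    have := (((hasDerivAt_id τ).fun_pow 2).sub ((hasDerivAt_id τ).const_mul σ)).add_const (σ ^ 2)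
    simpa using this
  refine ((h1.fun_div h2 hq.ne').log (by positivity)).congr_deriv ?_
  generalize τ ^ 2 - σ * τ + σ ^ 2 = q at hq
  field_simp

theorem hasDerivAt_arctan_cubic {σ : ℝ} (hσ : 0 < σ) (τ : ℝ) :
    HasDerivAt (fun τ => 1 / √3 * Real.arctan ((2 * τ + -σ) / (√3 * σ)))
      (σ / 2 / (τ ^ 2 - σ * τ + σ ^ 2)) τ := by
  have h3 : √3 ^ 2 = 3 := Real.sq_sqrt (by norm_num)
  have h30 : √3 ≠ 0 := by positivity
  have hq := (quadratic_pos hσ τ).ne'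
  have h1 : HasDerivAt (fun τ : ℝ => (2 * τ + -σ) / (√3 * σ)) (2 * 1 / (√3 * σ)) τ :=
    (((hasDerivAt_id τ).const_mul 2).add_const (-σ)).div_const _
  refine (h1.arctan.const_mul (1 / √3)).congr_deriv ?_
  have hq' : 1 + ((2 * τ + -σ) / (√3 * σ)) ^ 2 = 4 / 3 * (τ ^ 2 - σ * τ + σ ^ 2) / σ ^ 2 := by
    rw [div_pow, mul_pow, h3]; field_simp; ring
  rw [hq']
  field_simp
  rw [h3]; norm_num

theorem tendsto_log_cubic {σ : ℝ} (hσ : 0 < σ) :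
    Filter.Tendsto (fun τ => Real.log ((τ + σ) ^ 2 / (τ ^ 2 - σ * τ + σ ^ 2))) Filter.atTop
      (nhds 0) := by
  have h1 : Filter.Tendsto (fun τ : ℝ => (1 + σ * τ⁻¹) ^ 2 / (1 - σ * τ⁻¹ + (σ * τ⁻¹) ^ 2))
      Filter.atTop (nhds ((1 + σ * 0) ^ 2 / (1 - σ * 0 + (σ * 0) ^ 2))) := by
    have h := (tendsto_inv_atTop_zero (𝕜 := ℝ)).const_mul σ
    exact ((h.const_add 1).pow 2).div ((h.const_sub 1).add (h.pow 2)) (by simp)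
  have h2 := ((Real.continuousAt_log (x := (1 + σ * 0) ^ 2 / (1 - σ * 0 + (σ * 0) ^ 2))
    (by simp)).tendsto).comp h1
  simp only [mul_zero, add_zero, sub_zero, ne_eq, OfNat.ofNat_ne_zero, not_false_eq_true, zero_pow,
    one_pow, div_one, Real.log_one] at h2
  refine h2.congr' ?_
  filter_upwards [Filter.eventually_gt_atTop 0] with τ hτ
  have hq := quadratic_pos hσ τ
  simp only [Function.comp_apply]
  congr 1
  have e1 : 1 + σ * τ⁻¹ = (τ + σ) / τ := by field_simp
  have e2 : 1 - σ * τ⁻¹ + (σ * τ⁻¹) ^ 2 = (τ ^ 2 - σ * τ + σ ^ 2) / τ ^ 2 := by field_simp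
  rw [e1, e2, div_pow]
  field_simp

theorem integral_inv_cubic {σ : ℝ} (hσ : 0 < σ) :
    (IntegrableOn (fun τ : ℝ => (σ ^ 3 + τ ^ 3)⁻¹) (Set.Ioi 0) ∧
      ∫ τ in Set.Ioi (0 : ℝ), (σ ^ 3 + τ ^ 3)⁻¹ = 1 / σ ^ 2 * (2 * Real.pi / (3 * √3))) ∧
    (IntegrableOn (fun τ : ℝ => τ * (σ ^ 3 + τ ^ 3)⁻¹) (Set.Ioi 0) ∧
      ∫ τ in Set.Ioi (0 : ℝ), τ * (σ ^ 3 + τ ^ 3)⁻¹ = 1 / σ * (2 * Real.pi / (3 * √3))) := by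
  have hc : ∀ τ ∈ Set.Ioi (0 : ℝ), 0 ≤ (σ ^ 3 + τ ^ 3)⁻¹ := by
    intro τ hτ
    have : (0 : ℝ) < τ := hτ
    positivity
  have hc' : ∀ τ ∈ Set.Ioi (0 : ℝ), 0 ≤ τ * (σ ^ 3 + τ ^ 3)⁻¹ := fun τ hτ =>
    mul_nonneg (le_of_lt hτ) (hc τ hτ)
  have hfac : ∀ τ : ℝ, σ ^ 3 + τ ^ 3 = (τ + σ) * (τ ^ 2 - σ * τ + σ ^ 2) := fun τ => by ring
  have hd1 : ∀ τ ∈ Set.Ici (0 : ℝ), HasDerivAt (fun τ => 1 / σ ^ 2 *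
      (1 / 6 * Real.log ((τ + σ) ^ 2 / (τ ^ 2 - σ * τ + σ ^ 2)) +
        1 / √3 * Real.arctan ((2 * τ + -σ) / (√3 * σ)))) ((σ ^ 3 + τ ^ 3)⁻¹) τ := by
    intro τ hτ
    have hτ' : 0 ≤ τ := hτ
    have hq := (quadratic_pos hσ τ).ne'
    have hs : τ + σ ≠ 0 := by positivity
    refine ((((hasDerivAt_log_cubic hσ hτ').const_mul (1 / 6)).add
      (hasDerivAt_arctan_cubic hσ τ)).const_mul (1 / σ ^ 2)).congr_deriv ?_
    rw [hfac]
    generalize hQ : τ ^ 2 - σ * τ + σ ^ 2 = q at hq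
    field_simp
    rw [← hQ]
    ring
  have hd2 : ∀ τ ∈ Set.Ici (0 : ℝ), HasDerivAt (fun τ => 1 / σ *
      (-(1 / 6) * Real.log ((τ + σ) ^ 2 / (τ ^ 2 - σ * τ + σ ^ 2)) +
        1 / √3 * Real.arctan ((2 * τ + -σ) / (√3 * σ)))) (τ * (σ ^ 3 + τ ^ 3)⁻¹) τ := by
    intro τ hτ
    have hτ' : 0 ≤ τ := hτ
    have hq := (quadratic_pos hσ τ).ne'
    have hs : τ + σ ≠ 0 := by positivity
    refine ((((hasDerivAt_log_cubic hσ hτ').const_mul (-(1 / 6))).add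
      (hasDerivAt_arctan_cubic hσ τ)).const_mul (1 / σ)).congr_deriv ?_
    rw [hfac]
    generalize hQ : τ ^ 2 - σ * τ + σ ^ 2 = q at hq
    field_simp
    rw [← hQ]
    ring
  have hA := (tendsto_arctan_affine (a := 2) (b := -σ) (c := √3 * σ) (by norm_num)
    (by positivity)).const_mul (1 / √3)
  have hL := tendsto_log_cubic hσ
  have hl1 := ((hL.const_mul (1 / 6)).add hA).const_mul (1 / σ ^ 2)
  have hl2 := ((hL.const_mul (-(1 / 6))).add hA).const_mul (1 / σ)
  have hv : Real.arctan ((2 * 0 + -σ) / (√3 * σ)) = -(Real.pi / 6) := by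
    rw [← Real.arctan_inv_sqrt_three, ← Real.arctan_neg]
    congr 1
    field_simp
    ring
  have hv2 : Real.log ((0 + σ) ^ 2 / (0 ^ 2 - σ * 0 + σ ^ 2)) = 0 := by
    rw [show (0 + σ) ^ 2 / (0 ^ 2 - σ * 0 + σ ^ 2) = 1 by
      have : σ ^ 2 ≠ 0 := by positivity
      field_simp
      ring, Real.log_one]
  refine ⟨⟨integrableOn_Ioi_deriv_of_nonneg' hd1 hc hl1, ?_⟩,
    ⟨integrableOn_Ioi_deriv_of_nonneg' hd2 hc' hl2, ?_⟩⟩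
  · rw [integral_Ioi_of_hasDerivAt_of_nonneg' hd1 hc hl1, hv, hv2]
    field_simp
    ring
  · rw [integral_Ioi_of_hasDerivAt_of_nonneg' hd2 hc' hl2, hv, hv2]
    field_simp
    ring

theorem integral_cubic_mul_quadratic {σ : ℝ} (hσ : 0 < σ) :
    ∫ τ in Set.Ioi (0 : ℝ), (1 + τ + τ ^ 2)⁻¹ * (3 * σ ^ 2 / (σ ^ 3 + τ ^ 3))
      = 2 * Real.pi / (3 * √3) * (3 / (1 + σ)) := by
  obtain ⟨⟨i1, v1⟩, i2, v2⟩ := integral_inv_cubic hσ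
  obtain ⟨i3, v3⟩ := integral_inv_quadratic
  have h1 : ∫ τ in Set.Ioi (0 : ℝ), (1 + τ + τ ^ 2)⁻¹ * (3 * σ ^ 2 / (σ ^ 3 + τ ^ 3))
      = ∫ τ in Set.Ioi (0 : ℝ), 3 * σ ^ 2 / (1 + σ ^ 3) *
        (((σ ^ 3 + τ ^ 3)⁻¹ - τ * (σ ^ 3 + τ ^ 3)⁻¹) + (1 + τ + τ ^ 2)⁻¹) := by
    refine setIntegral_congr_fun measurableSet_Ioi fun τ hτ => ?_
    have : (0 : ℝ) < τ := hτ
    have h1 : σ ^ 3 + τ ^ 3 ≠ 0 := by positivity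
    have h2 : 1 + τ + τ ^ 2 ≠ 0 := by positivity
    have h3 : 1 + σ ^ 3 ≠ 0 := by positivity
    field_simp
    ring
  have i12 : IntegrableOn (fun τ : ℝ => (σ ^ 3 + τ ^ 3)⁻¹ - τ * (σ ^ 3 + τ ^ 3)⁻¹) (Set.Ioi 0) :=
    i1.sub i2
  rw [h1, integral_const_mul, integral_add i12 i3, integral_sub i1 i2, v1, v2, v3]
  have h3 : 1 + σ ^ 3 ≠ 0 := by positivity
  field_simp
  ring

/-- The density `3√3 / (2π (1 + τ + τ²))` of the limiting zero distribution in the variable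
`τ = ((z - 1) / (z + 1))^{1/3}`. -/
noncomputable def cubeRootDensity (τ : ℝ) : ℝ := 3 * √3 / (2 * Real.pi) * (1 + τ + τ ^ 2)⁻¹

theorem cubeRootDensity_nonneg (τ : ℝ) : 0 ≤ cubeRootDensity τ := by
  have h : 0 ≤ 1 + τ + τ ^ 2 := by nlinarith [sq_nonneg (2 * τ + 1)]
  have := Real.pi_pos
  unfold cubeRootDensity
  positivity

theorem continuous_cubeRootDensity : Continuous cubeRootDensity := by
  unfold cubeRootDensity
  refine continuous_const.mul (Continuous.inv₀ (by fun_prop) fun τ => ?_)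
  nlinarith [sq_nonneg (2 * τ + 1)]

/-- The limiting zero distribution in the variable `τ = ((z - 1) / (z + 1))^{1/3}`. -/
noncomputable def cubeRootMeasure : Measure ℝ :=
  (volume.restrict (Set.Ioi 0)).withDensity fun τ => ENNReal.ofReal (cubeRootDensity τ)

theorem integral_cubeRootMeasure (g : ℝ → ℝ) :
    ∫ τ, g τ ∂cubeRootMeasure = ∫ τ in Set.Ioi 0, cubeRootDensity τ * g τ := by
  rw [cubeRootMeasure, integral_withDensity_eq_integral_toReal_smul
    continuous_cubeRootDensity.measurable.ennreal_ofReal (by simp)]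
  simp [ENNReal.toReal_ofReal (cubeRootDensity_nonneg _)]

theorem integrableOn_cubeRootDensity : IntegrableOn cubeRootDensity (Set.Ioi 0) :=
  integral_inv_quadratic.1.const_mul _

theorem integral_cubeRootDensity : ∫ τ in Set.Ioi 0, cubeRootDensity τ = 1 := by
  have hpi := Real.pi_pos
  simp only [cubeRootDensity]
  rw [integral_const_mul, integral_inv_quadratic.2]
  field_simp

instance isProbabilityMeasure_cubeRootMeasure : IsProbabilityMeasure cubeRootMeasure := by
  constructor
  rw [cubeRootMeasure, withDensity_apply _ MeasurableSet.univ, Measure.restrict_univ,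
    ← ofReal_integral_eq_lintegral_ofReal integrableOn_cubeRootDensity
      (Filter.Eventually.of_forall cubeRootDensity_nonneg), integral_cubeRootDensity,
    ENNReal.ofReal_one]

theorem ae_pos_cubeRootMeasure : ∀ᵐ τ ∂cubeRootMeasure, 0 < τ := by
  have h : ∀ᵐ τ ∂(volume.restrict (Set.Ioi (0 : ℝ))), 0 < τ :=
    ae_restrict_mem measurableSet_Ioi
  exact (withDensity_absolutelyContinuous _ _).ae_le h

theorem ae_ne_cubeRootMeasure (a : ℝ) : ∀ᵐ τ ∂cubeRootMeasure, τ ≠ a := by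
  have h : ∀ᵐ τ ∂(volume : Measure ℝ), τ ≠ a := by
    simp [ae_iff]
  exact (withDensity_absolutelyContinuous _ _).ae_le (ae_restrict_of_ae h)

theorem abs_log_cube_ratio_le {σ τ : ℝ} (hσ : 0 < σ) (hτ : 0 < τ) :
    |Real.log ((σ ^ 3 + τ ^ 3) / (1 + τ ^ 3))| ≤ Real.log (σ ^ 3 + 1) - Real.log (σ ^ 3) +
      Real.log (σ ^ 3 + 1) := by
  have hs : 0 < σ ^ 3 := by positivity
  have ht : 0 < τ ^ 3 := by positivity
  have h1 : (σ ^ 3 + τ ^ 3) / (1 + τ ^ 3) ≤ σ ^ 3 + 1 := by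
    rw [div_le_iff₀ (by positivity)]; nlinarith
  have h2 : σ ^ 3 / (σ ^ 3 + 1) ≤ (σ ^ 3 + τ ^ 3) / (1 + τ ^ 3) := by
    rw [div_le_div_iff₀ (by positivity) (by positivity)]; nlinarith
  have l1 := Real.log_le_log (by positivity) h1
  have l2 := Real.log_le_log (by positivity) h2
  rw [Real.log_div (by positivity) (by positivity)] at l2
  have l3 : 0 ≤ Real.log (σ ^ 3 + 1) := Real.log_nonneg (by linarith)
  have l4 : Real.log (σ ^ 3) ≤ Real.log (σ ^ 3 + 1) := Real.log_le_log hs (by linarith)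
  rw [abs_le]
  constructor <;> linarith

theorem integrable_log_cube_ratio {σ : ℝ} (hσ : 0 < σ) :
    Integrable (fun τ => Real.log ((σ ^ 3 + τ ^ 3) / (1 + τ ^ 3))) cubeRootMeasure := by
  refine Integrable.of_bound (Measurable.aestronglyMeasurable (by fun_prop)) (Real.log (σ ^ 3 + 1) - Real.log (σ ^ 3) +
      Real.log (σ ^ 3 + 1)) ?_
  filter_upwards [ae_pos_cubeRootMeasure] with τ hτ
  exact abs_log_cube_ratio_le hσ hτ

theorem hasDerivAt_integral_log_cube_ratio {σ : ℝ} (hσ : 0 < σ) :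
    HasDerivAt (fun σ => ∫ τ, Real.log ((σ ^ 3 + τ ^ 3) / (1 + τ ^ 3)) ∂cubeRootMeasure)
      (3 / (1 + σ)) σ := by
  have hpi := Real.pi_pos
  have hs : Set.Ioi (σ / 2) ∈ nhds σ := Ioi_mem_nhds (by linarith)
  have key := hasDerivAt_integral_of_dominated_loc_of_deriv_le (μ := cubeRootMeasure)
    (F := fun σ τ => Real.log ((σ ^ 3 + τ ^ 3) / (1 + τ ^ 3)))
    (F' := fun σ τ => 3 * σ ^ 2 / (σ ^ 3 + τ ^ 3)) (bound := fun _ => 6 / σ) hs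
    (Filter.Eventually.of_forall fun x => Measurable.aestronglyMeasurable (by fun_prop)) (integrable_log_cube_ratio hσ)
    (Measurable.aestronglyMeasurable (by fun_prop)) ?_ (integrable_const _) ?_
  · refine key.2.congr_deriv ?_
    rw [integral_cubeRootMeasure]
    simp only [cubeRootDensity, mul_assoc]
    rw [integral_const_mul, integral_cubic_mul_quadratic hσ]
    field_simp
  · filter_upwards [ae_pos_cubeRootMeasure] with τ hτ x hx
    have hx' : σ / 2 < x := hx
    have hx0 : 0 < x := by linarith
    rw [Real.norm_eq_abs, abs_of_pos (by positivity), div_le_div_iff₀ (by positivity) hσ]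
    have : 0 < τ ^ 3 := by positivity
    have h1 : 0 < x ^ 2 := by positivity
    nlinarith [mul_pos h1 (sub_pos.2 hx')]
  · filter_upwards [ae_pos_cubeRootMeasure] with τ hτ x hx
    have hx' : σ / 2 < x := hx
    have hx0 : 0 < x := by linarith
    have h1 : HasDerivAt (fun x : ℝ => (x ^ 3 + τ ^ 3) / (1 + τ ^ 3)) (3 * x ^ 2 / (1 + τ ^ 3)) x := by
      simpa using (((hasDerivAt_id x).fun_pow 3).add_const (τ ^ 3)).div_const (1 + τ ^ 3)
    refine (h1.log (by positivity)).congr_deriv ?_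
    field_simp

theorem integral_log_cube_ratio {σ : ℝ} (hσ : 0 < σ) :
    ∫ τ, Real.log ((σ ^ 3 + τ ^ 3) / (1 + τ ^ 3)) ∂cubeRootMeasure = 3 * Real.log ((1 + σ) / 2) := by
  have hd : ∀ σ : ℝ, 0 < σ → HasDerivAt (fun σ =>
      (∫ τ, Real.log ((σ ^ 3 + τ ^ 3) / (1 + τ ^ 3)) ∂cubeRootMeasure) -
        3 * Real.log ((1 + σ) / 2)) 0 σ := by
    intro σ hσ
    have h1 : HasDerivAt (fun σ : ℝ => (1 + σ) / 2) (1 / 2) σ :=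
      ((hasDerivAt_id σ).const_add 1).div_const 2
    refine ((hasDerivAt_integral_log_cube_ratio hσ).fun_sub
      ((h1.log (by positivity)).const_mul 3)).congr_deriv ?_
    field_simp
    ring
  have hconst := isOpen_Ioi.is_const_of_deriv_eq_zero (𝕜 := ℝ) (s := Set.Ioi (0 : ℝ))
    isPreconnected_Ioi (fun σ hσ => (hd σ hσ).differentiableAt.differentiableWithinAt)
    (fun σ hσ => (hd σ hσ).deriv) hσ (Set.mem_Ioi.2 one_pos)
  have h1 : ∫ τ, Real.log (((1 : ℝ) ^ 3 + τ ^ 3) / (1 + τ ^ 3)) ∂cubeRootMeasure = 0 := by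
    rw [integral_eq_zero_of_ae]
    filter_upwards [ae_pos_cubeRootMeasure] with τ hτ
    rw [one_pow, div_self (by positivity), Real.log_one, Pi.zero_apply]
  rw [h1] at hconst
  norm_num at hconst
  linarith

theorem limitDensity_comp {τ : ℝ} (hτ : 0 < τ) (hτ1 : τ ≠ 1) :
    6 * τ ^ 2 / (1 - τ ^ 3) ^ 2 * limitDensity ((1 + τ ^ 3) / (1 - τ ^ 3)) = cubeRootDensity τ := by
  have hpi := Real.pi_pos
  have hpow : ∀ a : ℝ, 0 < a → (a ^ 3) ^ (-(1 : ℝ) / 3) = a⁻¹ := by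
    intro a ha
    rw [← Real.rpow_natCast, ← Real.rpow_mul ha.le]
    norm_num [Real.rpow_neg_one]
  have hm : ∀ a b : ℝ, 0 < a → 0 < b →
      (a ^ 3 * b) ^ (-(1 : ℝ) / 3) = a⁻¹ * b ^ (-(1 : ℝ) / 3) := by
    intro a b ha hb
    rw [Real.mul_rpow (by positivity) hb.le, hpow a ha]
  have hs3 : 0 < τ ^ 3 := by positivity
  have hq : 0 < 1 + τ + τ ^ 2 := by positivity
  rcases lt_or_gt_of_ne hτ1 with h | h
  · have h1 : 0 < 1 - τ := by linarith
    have h3 : 0 < 1 - τ ^ 3 := by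
      have : 1 - τ ^ 3 = (1 - τ) * (1 + τ + τ ^ 2) := by ring
      rw [this]; positivity
    have habs : |(1 + τ ^ 3) / (1 - τ ^ 3)| = (1 + τ ^ 3) / (1 - τ ^ 3) := abs_of_pos (by positivity)
    set B := (2 / (1 - τ ^ 3)) ^ (-(1 : ℝ) / 3) with hB
    have hB3 : B ^ 3 = (1 - τ ^ 3) / 2 := by
      rw [hB, ← Real.rpow_natCast, ← Real.rpow_mul (by positivity)]
      norm_num [Real.rpow_neg_one]
    have e1 : ((1 + τ ^ 3) / (1 - τ ^ 3)) ^ 2 - 1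
        = τ ^ 3 * ((2 / (1 - τ ^ 3)) * (2 / (1 - τ ^ 3))) := by field_simp; ring
    have e2 : (1 + τ ^ 3) / (1 - τ ^ 3) - 1 = τ ^ 3 * (2 / (1 - τ ^ 3)) := by field_simp; ring
    have e3 : (1 + τ ^ 3) / (1 - τ ^ 3) + 1 = 2 / (1 - τ ^ 3) := by field_simp; ring
    rw [limitDensity, habs, e1, e2, e3, hm _ _ hτ (by positivity), hm _ _ hτ (by positivity),
      Real.mul_rpow (by positivity) (by positivity), ← hB, cubeRootDensity]
    have : 6 * τ ^ 2 / (1 - τ ^ 3) ^ 2 *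
        (√3 / (2 * Real.pi) * (τ⁻¹ * (B * B)) * (τ⁻¹ * B - B))
        = 3 * √3 / Real.pi * (1 - τ) * B ^ 3 / (1 - τ ^ 3) ^ 2 := by
      field_simp
      ring
    rw [this, hB3]
    field_simp
    ring
  · have h1 : 0 < τ - 1 := by linarith
    have h3 : 0 < τ ^ 3 - 1 := by
      have : τ ^ 3 - 1 = (τ - 1) * (1 + τ + τ ^ 2) := by ring
      rw [this]; positivity
    have h3' : 1 - τ ^ 3 ≠ 0 := by linarith
    have hneg : (1 + τ ^ 3) / (1 - τ ^ 3) = -((1 + τ ^ 3) / (τ ^ 3 - 1)) := by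
      rw [← div_neg, neg_sub]
    have habs : |-((1 + τ ^ 3) / (τ ^ 3 - 1))| = (1 + τ ^ 3) / (τ ^ 3 - 1) := by
      rw [abs_neg, abs_of_pos (by positivity)]
    set B := (2 / (τ ^ 3 - 1)) ^ (-(1 : ℝ) / 3) with hB
    have hB3 : B ^ 3 = (τ ^ 3 - 1) / 2 := by
      rw [hB, ← Real.rpow_natCast, ← Real.rpow_mul (by positivity)]
      norm_num [Real.rpow_neg_one]
    have e1 : (-((1 + τ ^ 3) / (τ ^ 3 - 1))) ^ 2 - 1
        = τ ^ 3 * ((2 / (τ ^ 3 - 1)) * (2 / (τ ^ 3 - 1))) := by field_simp; ring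
    have e2 : (1 + τ ^ 3) / (τ ^ 3 - 1) + 1 = τ ^ 3 * (2 / (τ ^ 3 - 1)) := by field_simp; ring
    have e3 : (1 + τ ^ 3) / (τ ^ 3 - 1) - 1 = 2 / (τ ^ 3 - 1) := by field_simp; ring
    rw [hneg, limitDensity, habs, e1, e2, e3, hm _ _ hτ (by positivity), hm _ _ hτ (by positivity),
      Real.mul_rpow (by positivity) (by positivity), ← hB, cubeRootDensity]
    have h4 : (1 - τ ^ 3) ^ 2 = (τ ^ 3 - 1) ^ 2 := by ring
    have : 6 * τ ^ 2 / (τ ^ 3 - 1) ^ 2 *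
        (√3 / (2 * Real.pi) * (τ⁻¹ * (B * B)) * (B - τ⁻¹ * B))
        = 3 * √3 / Real.pi * (τ - 1) * B ^ 3 / (τ ^ 3 - 1) ^ 2 := by
      field_simp
      ring
    rw [h4, this, hB3]
    field_simp
    ring

theorem integral_limitDensity (φ : ℝ → ℝ) :
    ∫ x in {x : ℝ | 1 < |x|}, φ x * limitDensity x
      = ∫ τ, φ ((1 + τ ^ 3) / (1 - τ ^ 3)) ∂cubeRootMeasure := by
  set F : ℝ → ℝ := fun τ => (1 + τ ^ 3) / (1 - τ ^ 3) with hF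
  set s : Set ℝ := Set.Ioi 0 \ {1} with hs
  have hsm : MeasurableSet s := measurableSet_Ioi.diff (measurableSet_singleton 1)
  have hne : ∀ τ ∈ s, 1 - τ ^ 3 ≠ 0 := by
    rintro τ ⟨h0, h1⟩ h
    have h0' : (0 : ℝ) < τ := h0
    have : (τ - 1) * (1 + τ + τ ^ 2) = 0 := by linear_combination -h
    rcases mul_eq_zero.1 this with h2 | h2
    · exact h1 (by simpa using (sub_eq_zero.1 h2))
    · have : 0 < 1 + τ + τ ^ 2 := by positivity
      linarith
  have hder : ∀ τ ∈ s, HasDerivWithinAt F (6 * τ ^ 2 / (1 - τ ^ 3) ^ 2) s τ := by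
    intro τ hτ
    have h1 : HasDerivAt (fun τ : ℝ => 1 + τ ^ 3) (3 * τ ^ 2) τ := by
      simpa using ((hasDerivAt_id τ).fun_pow 3).const_add 1
    have h2 : HasDerivAt (fun τ : ℝ => 1 - τ ^ 3) (-(3 * τ ^ 2)) τ := by
      simpa using ((hasDerivAt_id τ).fun_pow 3).const_sub 1
    refine ((h1.fun_div h2 (hne τ hτ)).congr_deriv ?_).hasDerivWithinAt
    ring
  have hinj : Set.InjOn F s := by
    intro a ha b hb hab
    have ha' := hne a ha
    have hb' := hne b hb
    have ha0 : (0 : ℝ) < a := ha.1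
    have hb0 : (0 : ℝ) < b := hb.1
    simp only [hF] at hab
    rw [div_eq_div_iff ha' hb'] at hab
    have : a ^ 3 = b ^ 3 := by linarith
    exact (pow_left_inj₀ ha0.le hb0.le (by norm_num)).1 this
  have himg : F '' s = {x : ℝ | 1 < |x|} := by
    ext x
    constructor
    · rintro ⟨τ, hτ, rfl⟩
      have hτ0 : (0 : ℝ) < τ := hτ.1
      have h3 : 0 < τ ^ 3 := by positivity
      have hn := hne τ hτ
      rw [Set.mem_ofPred_eq, hF, abs_div, lt_div_iff₀ (abs_pos.2 hn), one_mul,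
        abs_of_pos (show 0 < 1 + τ ^ 3 by positivity), abs_lt]
      constructor <;> linarith
    · intro hx
      have hx' : 1 < |x| := hx
      have hx1 : x + 1 ≠ 0 := by
        intro h
        have : x = -1 := by linarith
        rw [this] at hx'; norm_num at hx'
      have hr : 0 < (x - 1) / (x + 1) := by
        have h1 : 0 < (x - 1) * (x + 1) := by
          have : 1 < x ^ 2 := by rw [← sq_abs]; nlinarith
          linarith
        have h2 : (x - 1) / (x + 1) = (x - 1) * (x + 1) / (x + 1) ^ 2 := by field_simp
        rw [h2]
        positivity
      have hc : (((x - 1) / (x + 1)) ^ ((1 : ℝ) / 3)) ^ 3 = (x - 1) / (x + 1) := by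
        rw [← Real.rpow_natCast, ← Real.rpow_mul hr.le]
        norm_num
      refine ⟨((x - 1) / (x + 1)) ^ ((1 : ℝ) / 3), ⟨Real.rpow_pos_of_pos hr _, ?_⟩, ?_⟩
      · intro h
        rw [Set.mem_singleton_iff] at h
        rw [h, one_pow, eq_div_iff hx1] at hc
        linarith
      · simp only [hF]
        rw [hc]
        have : 1 - (x - 1) / (x + 1) = 2 / (x + 1) := by field_simp; ring
        rw [this]
        field_simp
        ring
  rw [← himg, integral_image_eq_integral_abs_deriv_smul hsm hder hinj, integral_cubeRootMeasure]
  have hset : ∫ τ in Set.Ioi 0, cubeRootDensity τ * φ (F τ) = ∫ τ in s, cubeRootDensity τ * φ (F τ) :=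
    (setIntegral_congr_set (sdiff_null_ae_eq_self (by simp))).symm
  rw [hset]
  refine setIntegral_congr_fun hsm fun τ hτ => ?_
  have hτ0 : (0 : ℝ) < τ := hτ.1
  simp only [smul_eq_mul]
  rw [abs_of_nonneg (by positivity), ← limitDensity_comp hτ0 (fun h => hτ.2 h)]
  ring

/-- The normalized sums of `g` over the multisets `W n` converge to the integral of `g`. -/
def MeanTendsto (W : ℕ → Multiset ℝ) (μ : Measure ℝ) (g : ℝ → ℝ) : Prop :=
  Integrable g μ ∧
    Filter.Tendsto (fun n : ℕ => (n : ℝ)⁻¹ * ((W n).map g).sum) Filter.atTop (nhds (∫ x, g x ∂μ))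

namespace MeanTendsto

variable {W : ℕ → Multiset ℝ} {μ : Measure ℝ} {g h : ℝ → ℝ}

theorem add (hg : MeanTendsto W μ g) (hh : MeanTendsto W μ h) :
    MeanTendsto W μ fun x => g x + h x := by
  refine ⟨hg.1.add hh.1, ?_⟩
  rw [integral_add hg.1 hh.1]
  simpa only [Multiset.sum_map_add, mul_add] using hg.2.add hh.2

theorem const_mul (hg : MeanTendsto W μ g) (c : ℝ) : MeanTendsto W μ fun x => c * g x := by
  refine ⟨hg.1.const_mul c, ?_⟩
  rw [integral_const_mul]
  simpa only [Multiset.sum_map_mul_left, mul_left_comm] using hg.2.const_mul c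

theorem const [IsProbabilityMeasure μ] (hW : ∀ n, (W n).card = n) (c : ℝ) :
    MeanTendsto W μ fun _ => c := by
  refine ⟨integrable_const c, ?_⟩
  refine Filter.Tendsto.congr' ?_ (tendsto_const_nhds (x := ∫ _, c ∂μ))
  filter_upwards [Filter.eventually_gt_atTop 0] with n hn
  have : (n : ℝ) ≠ 0 := by positivity
  simp [hW]
  field_simp

theorem sum [IsProbabilityMeasure μ] (hW : ∀ n, (W n).card = n) {ι : Type*} (s : Finset ι)
    {g : ι → ℝ → ℝ} (hg : ∀ i ∈ s, MeanTendsto W μ (g i)) :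
    MeanTendsto W μ fun x => ∑ i ∈ s, g i x := by
  classical
  induction s using Finset.induction_on with
  | empty => simpa using const hW 0
  | insert a s ha ih =>
    simp only [Finset.sum_insert ha]
    exact (hg a (by simp)).add (ih fun i hi => hg i (by simp [hi]))

theorem of_approx (hW1 : ∀ n, ∀ x ∈ W n, |x| ≤ 1) (hμ : ∀ᵐ x ∂μ, |x| ≤ 1)
    (hg : Integrable g μ)
    (happ : ∀ ε > 0, ∃ g' h : ℝ → ℝ, MeanTendsto W μ g' ∧ MeanTendsto W μ h ∧
      ∫ x, h x ∂μ ≤ ε ∧ ∀ x, |x| ≤ 1 → |g x - g' x| ≤ h x) : MeanTendsto W μ g := by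
  refine ⟨hg, Metric.tendsto_nhds.2 fun ε hε => ?_⟩
  obtain ⟨g', h, hg', hh, hhε, hb⟩ := happ (ε / 4) (by positivity)
  have hint : |∫ x, g x ∂μ - ∫ x, g' x ∂μ| ≤ ∫ x, h x ∂μ := by
    rw [← integral_sub hg hg'.1]
    refine (abs_integral_le_integral_abs).trans ?_
    refine integral_mono_ae (hg.sub hg'.1).abs hh.1 ?_
    filter_upwards [hμ] with x hx using hb x hx
  filter_upwards [Metric.tendsto_nhds.1 hg'.2 (ε / 4) (by positivity),
    Metric.tendsto_nhds.1 hh.2 (ε / 4) (by positivity)] with n h1 h2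
  rw [Real.dist_eq] at h1 h2 ⊢
  have hsum : |((W n).map g).sum - ((W n).map g').sum| ≤ ((W n).map h).sum := by
    rw [← Multiset.sum_map_sub]
    refine (Multiset.abs_sum_le_sum_abs).trans ?_
    rw [Multiset.map_map]
    exact Multiset.sum_map_le_sum_map _ _ fun x hx => hb x (hW1 n x hx)
  have hA : |(n : ℝ)⁻¹ * ((W n).map g).sum - (n : ℝ)⁻¹ * ((W n).map g').sum| ≤
      (n : ℝ)⁻¹ * ((W n).map h).sum := by
    rw [← mul_sub, abs_mul, abs_of_nonneg (by positivity : (0 : ℝ) ≤ (n : ℝ)⁻¹)]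
    gcongr
  rw [abs_lt] at h1 h2 ⊢
  rw [abs_le] at hA hint
  constructor <;> linarith [h1.1, h1.2, h2.2, hA.1, hA.2, hint.1, hint.2]

theorem of_continuous [IsProbabilityMeasure μ] (hW : ∀ n, (W n).card = n)
    (hW1 : ∀ n, ∀ x ∈ W n, |x| ≤ 1) (hμ : ∀ᵐ x ∂μ, |x| ≤ 1)
    (hlog : ∀ y, 0 < y → y < 1 → MeanTendsto W μ fun x => Real.log (1 - y * x))
    (hg : Continuous g) : MeanTendsto W μ g := by
  have hbdd : ∀ k : ℝ → ℝ, Continuous k → Integrable k μ := by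
    intro k hk
    obtain ⟨B, hB⟩ := (isCompact_Icc (a := (-1 : ℝ)) (b := 1)).exists_bound_of_continuousOn
      hk.continuousOn
    refine Integrable.of_bound hk.aestronglyMeasurable B ?_
    filter_upwards [hμ] with x hx using hB x (abs_le.1 hx)
  have hpow : ∀ m : ℕ, MeanTendsto W μ fun x => x ^ m := by
    intro m
    induction m using Nat.strong_induction_on with
    | _ m ih =>
      rcases m with - | m
      · simpa using const hW 1
      refine of_approx hW1 hμ (hbdd _ (by fun_prop)) fun ε hε => ?_
      set y : ℝ := min (1 / 2) (ε / (2 * (m + 1))) with hy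
      have hm : (0 : ℝ) < m + 1 := by positivity
      have hy0 : 0 < y := lt_min (by norm_num) (by positivity)
      have hy1 : y ≤ 1 / 2 := min_le_left _ _
      have hy2 : y * (2 * (m + 1)) ≤ ε := by
        rw [← le_div_iff₀ (by positivity)]; exact min_le_right _ _
      refine ⟨fun x => -((m + 1) / y ^ (m + 1)) * (Real.log (1 - y * x) +
        ∑ i ∈ Finset.range m, y ^ (i + 1) / (i + 1) * x ^ (i + 1)), fun _ => ε, ?_,
        const hW ε, by simp, fun x hx => ?_⟩
      · refine ((hlog y hy0 (by linarith)).add (sum hW _ fun i hi => ?_)).const_mul _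
        exact (ih (i + 1) (by simpa using hi)).const_mul _
      · have hyx : |y * x| ≤ y := by
          rw [abs_mul, abs_of_pos hy0]; nlinarith
        have h1 := Real.abs_log_sub_add_sum_range_le (x := y * x) (by linarith) (m + 1)
        have h2 : |y * x| ^ (m + 1 + 1) / (1 - |y * x|) ≤ y ^ (m + 2) / (1 / 2) := by
          gcongr
          linarith
        rw [Finset.sum_range_succ] at h1
        have e : x ^ (m + 1) - -((m + 1) / y ^ (m + 1)) * (Real.log (1 - y * x) +
            ∑ i ∈ Finset.range m, y ^ (i + 1) / (i + 1) * x ^ (i + 1)) =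
            (m + 1) / y ^ (m + 1) * (∑ i ∈ Finset.range m, (y * x) ^ (i + 1) / (i + 1) +
              (y * x) ^ (m + 1) / (m + 1) + Real.log (1 - y * x)) := by
          have : ∀ i : ℕ, y ^ (i + 1) / ((i : ℝ) + 1) * x ^ (i + 1) =
              (y * x) ^ (i + 1) / (i + 1) := fun i => by rw [mul_pow]; ring
          simp only [this]
          rw [mul_pow]
          field_simp
          ring
        rw [e, abs_mul, abs_of_pos (by positivity)]
        calc _ ≤ (m + 1) / y ^ (m + 1) * (y ^ (m + 2) / (1 / 2)) := by
              gcongr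
              exact h1.trans h2
          _ = y * (2 * (m + 1)) := by field_simp; ring
          _ ≤ ε := hy2
  refine of_approx hW1 hμ (hbdd _ hg) fun ε hε => ?_
  obtain ⟨p, hp⟩ := exists_polynomial_near_of_continuousOn (-1) 1 g hg.continuousOn ε hε
  refine ⟨fun x => p.eval x, fun _ => ε, ?_, const hW ε, by simp, fun x hx => ?_⟩
  · simp only [Polynomial.eval_eq_sum_range]
    exact sum hW _ fun i _ => (hpow i).const_mul _
  · rw [abs_sub_comm]
    exact (hp x (abs_le.1 hx)).le

theorem of_continuousOn_compl_zero [IsProbabilityMeasure μ] (hW : ∀ n, (W n).card = n)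
    (hW1 : ∀ n, ∀ x ∈ W n, |x| ≤ 1) (hμ : ∀ᵐ x ∂μ, |x| ≤ 1) (hμ0 : ∀ᵐ x ∂μ, x ≠ 0)
    (hlog : ∀ y, 0 < y → y < 1 → MeanTendsto W μ fun x => Real.log (1 - y * x))
    (hg : ContinuousOn g {0}ᶜ) (hgm : Measurable g) {B : ℝ} (hB : ∀ x, |g x| ≤ B) :
    MeanTendsto W μ g := by
  have hB0 : 0 ≤ B := (abs_nonneg _).trans (hB 0)
  refine of_approx hW1 hμ (Integrable.of_bound hgm.aestronglyMeasurable B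
    (Filter.Eventually.of_forall hB)) fun ε hε => ?_
  have hlim : Filter.Tendsto (fun k : ℕ => ∫ x, B * max 0 (1 - (k + 1) * |x|) ∂μ) Filter.atTop
      (nhds (∫ _, (0 : ℝ) ∂μ)) := by
    refine tendsto_integral_of_dominated_convergence (fun _ => B)
      (fun k => Continuous.aestronglyMeasurable (by fun_prop)) (integrable_const B)
      (fun k => Filter.Eventually.of_forall fun x => ?_) ?_
    · rw [Real.norm_eq_abs, abs_of_nonneg (by positivity)]
      have : max 0 (1 - ((k : ℝ) + 1) * |x|) ≤ 1 :=
        max_le zero_le_one (by have : 0 ≤ ((k : ℝ) + 1) * |x| := by positivity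
                               linarith)
      nlinarith
    · filter_upwards [hμ0] with x hx
      refine Filter.Tendsto.congr' ?_ tendsto_const_nhds
      obtain ⟨K, hK⟩ := exists_nat_gt (|x|⁻¹)
      have hx0 : 0 < |x| := abs_pos.2 hx
      filter_upwards [Filter.eventually_ge_atTop K] with k hk
      have hk' : (K : ℝ) ≤ k := by exact_mod_cast hk
      have : 1 ≤ ((k : ℝ) + 1) * |x| := by
        calc (1 : ℝ) = |x|⁻¹ * |x| := (inv_mul_cancel₀ hx0.ne').symm
          _ ≤ ((k : ℝ) + 1) * |x| := mul_le_mul_of_nonneg_right (by linarith) hx0.le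
      rw [max_eq_left (by linarith), mul_zero]
  rw [integral_zero] at hlim
  obtain ⟨k, hk⟩ := (hlim.eventually (gt_mem_nhds hε)).exists
  refine ⟨fun x => g x * min 1 ((k + 1) * |x|), fun x => B * max 0 (1 - (k + 1) * |x|),
    of_continuous hW hW1 hμ hlog (continuous_iff_continuousAt.2 fun x => ?_),
    of_continuous hW hW1 hμ hlog (by fun_prop), hk.le, fun x _ => ?_⟩
  · by_cases hx : x = 0
    · subst hx
      have h0 : g 0 * min 1 (((k : ℝ) + 1) * |(0 : ℝ)|) = 0 := by simp
      rw [ContinuousAt, h0]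
      refine squeeze_zero_norm (a := fun x => B * (((k : ℝ) + 1) * |x|)) (fun x => ?_) ?_
      · rw [Real.norm_eq_abs, abs_mul, abs_of_nonneg (a := min _ _) (by positivity)]
        exact mul_le_mul (hB x) (min_le_right _ _) (by positivity) hB0
      · have : Continuous fun x : ℝ => B * (((k : ℝ) + 1) * |x|) := by fun_prop
        simpa using this.tendsto 0
    · exact (hg.continuousAt (isOpen_compl_singleton.mem_nhds hx)).mul
        (Continuous.continuousAt (by fun_prop))
  · have e : 1 - min 1 (((k : ℝ) + 1) * |x|) = max 0 (1 - (k + 1) * |x|) := by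
      rcases le_total 1 (((k : ℝ) + 1) * |x|) with h | h
      · rw [min_eq_left h, max_eq_left (by linarith)]; ring
      · rw [min_eq_right h, max_eq_right (by linarith)]
    beta_reduce
    rw [← e]
    have : g x - g x * min 1 (((k : ℝ) + 1) * |x|) = g x * (1 - min 1 (((k : ℝ) + 1) * |x|)) := by
      ring
    rw [this, abs_mul, abs_of_nonneg (a := 1 - _) (by linarith [min_le_left 1 (((k : ℝ) + 1) * |x|)])]
    gcongr
    · linarith [min_le_left 1 (((k : ℝ) + 1) * |x|)]
    · exact hB x

end MeanTendsto

theorem branch_eq_rpow {α : ℝ} {f : ℂ → ℂ}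
    (hf : DifferentiableOn ℂ f {z : ℂ | ¬(z.im = 0 ∧ -1 ≤ z.re ∧ z.re ≤ 1)})
    (hf1 : Filter.Tendsto f (Bornology.cobounded ℂ) (nhds 1))
    (hbranch : ∀ z : ℂ, ¬(z.im = 0 ∧ -1 ≤ z.re ∧ z.re ≤ 1) →
      (z ^ 2 - 1) * deriv f z = 2 * (α : ℂ) * f z) {x : ℝ} (hx : 1 < x) :
    f x = Complex.exp (α * Real.log ((x - 1) / (x + 1)) : ℝ) := by
  set S := {z : ℂ | ¬(z.im = 0 ∧ -1 ≤ z.re ∧ z.re ≤ 1)} with hS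
  have hopen : IsOpen S := by
    have : IsClosed {z : ℂ | z.im = 0 ∧ -1 ≤ z.re ∧ z.re ≤ 1} :=
      (isClosed_eq Complex.continuous_im continuous_const).inter
        ((isClosed_le continuous_const Complex.continuous_re).inter
          (isClosed_le Complex.continuous_re continuous_const))
    exact this.isOpen_compl
  have hmem : ∀ x : ℝ, 1 < x → (x : ℂ) ∈ S := by
    intro x hx h
    have := h.2.2
    simp at this
    linarith
  set h : ℝ → ℝ := fun x => α * Real.log ((x - 1) / (x + 1)) with hh
  have hder : ∀ x : ℝ, 1 < x →
      HasDerivAt (fun x : ℝ => f x * Complex.exp (-(h x : ℂ))) 0 x := by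
    intro x hx
    have h1 : HasDerivAt (fun x : ℝ => f x) (deriv f x) x :=
      ((hf.differentiableAt (hopen.mem_nhds (hmem x hx))).hasDerivAt).comp_ofReal
    have h2 : HasDerivAt h (α * (2 / (x ^ 2 - 1))) x := by
      have hp : HasDerivAt (fun x : ℝ => (x - 1) / (x + 1))
          ((1 * (x + 1) - (x - 1) * 1) / (x + 1) ^ 2) x :=
        ((hasDerivAt_id x).sub_const 1).div ((hasDerivAt_id x).add_const 1) (by simp; linarith)
      have hx1 : x - 1 ≠ 0 := by linarith
      have hx2 : x + 1 ≠ 0 := by linarith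
      have hx3 : x ^ 2 - 1 ≠ 0 := by nlinarith
      refine ((hp.log (div_ne_zero hx1 hx2)).const_mul α).congr_deriv ?_
      field_simp
      ring
    have h3 := h2.ofReal_comp.neg.cexp
    refine (h1.mul h3).congr_deriv ?_
    have hx3 : ((x : ℂ) ^ 2 - 1) ≠ 0 := by
      have : x ^ 2 - 1 ≠ 0 := by nlinarith
      exact_mod_cast this
    have hb := hbranch x (hmem x hx)
    have hb' : deriv f x = 2 * α * f x / ((x : ℂ) ^ 2 - 1) := by
      rw [eq_div_iff hx3, ← hb]; ring
    rw [hb']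
    push_cast
    simp only [Pi.neg_apply]
    field_simp
    ring
  have hconst : ∀ y : ℝ, 1 < y →
      f y * Complex.exp (-(h y : ℂ)) = f x * Complex.exp (-(h x : ℂ)) := by
    intro y hy
    exact isOpen_Ioi.is_const_of_deriv_eq_zero isPreconnected_Ioi
      (fun z hz => (hder z hz).differentiableAt.differentiableWithinAt)
      (fun z hz => (hder z hz).deriv) hy hx
  have hlim : Filter.Tendsto (fun y : ℝ => f y * Complex.exp (-(h y : ℂ))) Filter.atTop
      (nhds (1 * Complex.exp (-((α * Real.log 1 : ℝ) : ℂ)))) := by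
    refine Filter.Tendsto.mul (hf1.comp ?_) ?_
    · rw [← tendsto_norm_atTop_iff_cobounded]
      simpa using Filter.tendsto_abs_atTop_atTop
    · refine (Complex.continuous_exp.tendsto _).comp (Filter.Tendsto.neg ?_)
      refine (Complex.continuous_ofReal.tendsto _).comp (Filter.Tendsto.const_mul _ ?_)
      refine (Real.continuousAt_log one_ne_zero).tendsto.comp ?_
      have : Filter.Tendsto (fun y : ℝ => 1 - 2 * (y + 1)⁻¹) Filter.atTop
          (nhds (1 - 2 * 0)) :=
        tendsto_const_nhds.sub ((tendsto_inv_atTop_zero.comp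
          (Filter.tendsto_atTop_add_const_right _ 1 Filter.tendsto_id)).const_mul 2)
      rw [mul_zero, sub_zero] at this
      refine this.congr' ?_
      filter_upwards [Filter.eventually_gt_atTop 1] with y hy
      have : y + 1 ≠ 0 := by linarith
      field_simp
      ring
  have hone : f x * Complex.exp (-(h x : ℂ)) = 1 := by
    refine tendsto_nhds_unique (tendsto_const_nhds.congr' ?_) (by simpa using hlim)
    filter_upwards [Filter.eventually_gt_atTop 1] with y hy using (hconst y hy).symm
  rw [Complex.exp_neg] at hone
  exact (mul_inv_eq_one₀ (Complex.exp_ne_zero _)).1 hone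

theorem coeff_eq_zero_of_norm_eval_le (M : ℕ) : ∀ (p : Polynomial ℂ) (C δ : ℝ), 0 < δ →
    (∀ u : ℝ, 0 < u → u < δ → ‖p.eval (u : ℂ)‖ ≤ C * u ^ M) → ∀ m < M, p.coeff m = 0 := by
  induction M with
  | zero => intro p C δ _ _ m hm; omega
  | succ M ih =>
    intro p C δ hδ hp
    have h0 : p.coeff 0 = 0 := by
      have h1 : Filter.Tendsto (fun u : ℝ => p.eval (u : ℂ)) (nhdsWithin 0 (Set.Ioi 0))
          (nhds (p.eval ((0 : ℝ) : ℂ))) :=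
        ((p.continuous.comp Complex.continuous_ofReal).tendsto 0).mono_left nhdsWithin_le_nhds
      have h2 : Filter.Tendsto (fun u : ℝ => p.eval (u : ℂ)) (nhdsWithin 0 (Set.Ioi 0))
          (nhds 0) := by
        refine squeeze_zero_norm' (a := fun u => C * u ^ (M + 1)) ?_ ?_
        · filter_upwards [Ioo_mem_nhdsGT hδ] with u hu using hp u hu.1 hu.2
        · have : Continuous fun u : ℝ => C * u ^ (M + 1) := by fun_prop
          simpa using (this.tendsto 0).mono_left nhdsWithin_le_nhds
      rw [Polynomial.coeff_zero_eq_eval_zero]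
      simpa using tendsto_nhds_unique h1 h2
    have hdiv : Polynomial.X * p.divX = p := by
      simpa [h0] using p.X_mul_divX_add
    intro m hm
    rcases m with - | m
    · exact h0
    · rw [← Polynomial.coeff_divX]
      refine ih p.divX C δ hδ (fun u hu hu' => ?_) m (by omega)
      have h1 := hp u hu hu'
      rw [← hdiv, Polynomial.eval_mul, Polynomial.eval_X, norm_mul, Complex.norm_real,
        Real.norm_eq_abs, abs_of_pos hu] at h1
      refine le_of_mul_le_mul_left (h1.trans_eq ?_) hu
      ring

theorem moments_eq_zero {ι : Type*} (s : Finset ι) (c : ι → ℂ) (v : ι → ℝ) (M : ℕ)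
    {C δ : ℝ} (hδ : 0 < δ)
    (h : ∀ u : ℝ, 0 < u → u < δ → ‖∑ i ∈ s, c i * Complex.exp (v i * u)‖ ≤ C * u ^ M) :
    ∀ m < M, ∑ i ∈ s, c i * (v i : ℂ) ^ m = 0 := by
  intro m hm
  have hM : 0 < M := by omega
  set p : Polynomial ℂ := ∑ k ∈ Finset.range M,
    Polynomial.C ((∑ i ∈ s, c i * (v i : ℂ) ^ k) / (k.factorial : ℂ)) * Polynomial.X ^ k with hp
  set L : ℝ := 1 + ∑ i ∈ s, |v i| with hL
  have hL0 : 0 < L := by positivity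
  have hvL : ∀ i ∈ s, |v i| ≤ L := fun i hi => by
    have := Finset.single_le_sum (f := fun i => |v i|) (fun i _ => abs_nonneg (v i)) hi
    linarith
  set K : ℝ := (M.succ : ℝ) * ((M.factorial : ℝ) * M)⁻¹ with hK
  have hco := coeff_eq_zero_of_norm_eval_le M p (C + ∑ i ∈ s, ‖c i‖ * (|v i| ^ M * K))
    (min δ L⁻¹) (by positivity) (fun u hu hu' => by
      have hu1 : u < δ := hu'.trans_le (min_le_left _ _)
      have hu2 : u * L ≤ 1 := by
        rw [← le_div_iff₀ hL0, one_div]; exact (hu'.trans_le (min_le_right _ _)).le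
      have e : p.eval (u : ℂ) = (∑ i ∈ s, c i * Complex.exp (v i * u)) -
          ∑ i ∈ s, c i * (Complex.exp (v i * u) -
            ∑ k ∈ Finset.range M, (v i * u : ℂ) ^ k / k.factorial) := by
        rw [← Finset.sum_sub_distrib, hp, Polynomial.eval_finsetSum]
        simp only [Polynomial.eval_mul, Polynomial.eval_C, Polynomial.eval_pow,
          Polynomial.eval_X, mul_sub, sub_sub_cancel, Finset.mul_sum, Finset.sum_div,
          Finset.sum_mul]
        rw [Finset.sum_comm]
        refine Finset.sum_congr rfl fun i _ => Finset.sum_congr rfl fun k _ => ?_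
        rw [mul_pow]
        ring
      rw [e]
      refine (norm_sub_le _ _).trans ?_
      rw [add_mul]
      refine add_le_add (h u hu hu1) ?_
      refine (norm_sum_le _ _).trans ?_
      rw [Finset.sum_mul]
      refine Finset.sum_le_sum fun i hi => ?_
      have hn : ‖(v i * u : ℂ)‖ = |v i| * u := by
        rw [norm_mul, Complex.norm_real, Complex.norm_real, Real.norm_eq_abs, Real.norm_eq_abs,
          abs_of_pos hu]
      have hb := Complex.exp_bound (x := (v i * u : ℂ)) (by
        rw [hn]
        nlinarith [hvL i hi]) hM
      rw [hn] at hb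
      rw [norm_mul]
      calc _ ≤ ‖c i‖ * ((|v i| * u) ^ M * K) := by gcongr
        _ = _ := by rw [mul_pow]; ring) m hm
  have : p.coeff m = (∑ i ∈ s, c i * (v i : ℂ) ^ m) / (m.factorial : ℂ) := by
    simp only [hp, Polynomial.finsetSum_coeff, Polynomial.coeff_C_mul, Polynomial.coeff_X_pow]
    simp [hm]
  rw [this, div_eq_zero_iff] at hco
  exact hco.resolve_right (by exact_mod_cast m.factorial_ne_zero)

theorem exists_mul_prod_sub_eq {ι : Type*} [Fintype ι] [DecidableEq ι] {v c : ι → ℂ}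
    (h : ∀ m < Fintype.card ι - 1, ∑ i, c i * v i ^ m = 0) :
    ∃ κ : ℂ, ∀ i, c i * ∏ k ∈ Finset.univ.erase i, (v i - v k) = κ := by
  have hpoly : ∀ q : Polynomial ℂ, q.natDegree < Fintype.card ι - 1 →
      ∑ i, c i * q.eval (v i) = 0 := by
    intro q hq
    simp only [Polynomial.eval_eq_sum_range, Finset.mul_sum]
    rw [Finset.sum_comm]
    refine Finset.sum_eq_zero fun m hm => ?_
    have := h m (by rw [Finset.mem_range] at hm; omega)
    calc _ = q.coeff m * ∑ i, c i * v i ^ m := by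
          rw [Finset.mul_sum]; exact Finset.sum_congr rfl fun _ _ => by ring
      _ = 0 := by rw [this, mul_zero]
  have hpair : ∀ i j, i ≠ j → c i * ∏ k ∈ Finset.univ.erase i, (v i - v k) =
      c j * ∏ k ∈ Finset.univ.erase j, (v j - v k) := by
    intro i j hij
    set s : Finset ι := (Finset.univ.erase i).erase j with hs
    set q : Polynomial ℂ := ∏ k ∈ s, (Polynomial.X - Polynomial.C (v k)) with hq
    have hji : j ∈ Finset.univ.erase i := by simp [hij.symm]
    have hij' : i ∈ Finset.univ.erase j := by simp [hij]
    have hs' : s = (Finset.univ.erase j).erase i := Finset.erase_right_comm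
    have hcard : s.card + 1 = Fintype.card ι - 1 := by
      rw [hs, Finset.card_erase_add_one hji, Finset.card_erase_of_mem (Finset.mem_univ i),
        Finset.card_univ]
    have hdeg : q.natDegree = s.card := Polynomial.natDegree_finsetProd_X_sub_C_eq_card _ _
    have hsum := hpoly q (by omega)
    have hev : ∀ x, q.eval x = ∏ k ∈ s, (x - v k) := by
      intro x
      simp [hq, Polynomial.eval_prod]
    rw [← Finset.add_sum_erase _ _ (Finset.mem_univ i), ← Finset.add_sum_erase _ _ hji,
      Finset.sum_eq_zero (fun k hk => by
        rw [hev, Finset.prod_eq_zero hk (sub_self _), mul_zero]), add_zero, hev, hev] at hsum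
    rw [← Finset.mul_prod_erase _ _ hji, ← Finset.mul_prod_erase _ _ hij', ← hs', ← hs]
    linear_combination (v i - v j) * hsum
  rcases isEmpty_or_nonempty ι with he | ⟨⟨i₀⟩⟩
  · exact ⟨0, fun i => he.elim i⟩
  · refine ⟨c i₀ * ∏ k ∈ Finset.univ.erase i₀, (v i₀ - v k), fun i => ?_⟩
    by_cases hi : i = i₀
    · rw [hi]
    · exact hpair i i₀ hi

theorem prod_erase_add_sub (d : ℝ) (k m : ℕ) :
    ∏ i ∈ (Finset.range (k + m + 1)).erase k, (d + k - i) =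
      (-1) ^ m * (shiftedPoch d k * shiftedPoch (-d) m) := by
  induction m with
  | zero =>
    have : (Finset.range (k + 0 + 1)).erase k = Finset.range k := by
      ext i; simp; omega
    rw [this, ← Finset.prod_range_reflect]
    simp only [shiftedPoch, Finset.range_zero, Finset.prod_empty, pow_zero, mul_one, one_mul]
    refine Finset.prod_congr rfl fun i hi => ?_
    have hi' : i < k := Finset.mem_range.1 hi
    rw [Nat.cast_sub (by omega), Nat.cast_sub (by omega)]
    push_cast
    ring
  | succ m ih =>
    rw [show k + (m + 1) + 1 = k + m + 1 + 1 by ring, Finset.range_add_one,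
      Finset.erase_insert_of_ne (by omega), Finset.prod_insert (by simp), ih]
    simp only [shiftedPoch, Finset.prod_range_succ _ m]
    push_cast
    ring

theorem shiftedPoch_zero_left (k : ℕ) : shiftedPoch 0 k = k.factorial := by
  rw [shiftedPoch, ← Finset.prod_range_add_one_eq_factorial]
  push_cast
  exact Finset.prod_congr rfl fun i _ => by ring

theorem prod_fin_erase (g : ℕ → ℝ) {n : ℕ} (k : Fin (n + 1)) :
    ∏ i ∈ Finset.univ.erase k, g (i : ℕ) = ∏ i ∈ (Finset.range (n + 1)).erase k, g i := by
  refine Finset.prod_bij (fun i _ => (i : ℕ)) ?_ ?_ ?_ ?_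
  · intro i hi
    simp only [Finset.mem_erase, Finset.mem_univ, and_true, Finset.mem_range] at hi ⊢
    exact ⟨fun h => hi (Fin.ext h), i.2⟩
  · intro i _ j _ h
    exact Fin.ext h
  · intro i hi
    simp only [Finset.mem_erase, Finset.mem_range] at hi
    exact ⟨⟨i, hi.2⟩, by simpa [Fin.ext_iff] using hi.1, rfl⟩
  · intros; rfl

theorem prod_fin_add_sub (d : ℝ) {n : ℕ} (k : Fin (n + 1)) :
    ∏ i ∈ Finset.univ.erase k, (d + (k : ℕ) - (i : ℕ)) =
      (-1) ^ (n - k) * (shiftedPoch d k * shiftedPoch (-d) (n - k)) := by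
  have hk : (k : ℕ) + (n - k) = n := by have := k.2; omega
  have := prod_erase_add_sub d k (n - k)
  rw [hk] at this
  rw [← this]
  exact prod_fin_erase (fun i => d + (k : ℕ) - i) k

theorem erase_prod_eq_mul {M : Type*} [CommMonoid M] {n : ℕ} (g : Fin 3 × Fin n → M) (j : Fin 3)
    (k : Fin n) :
    ∏ p ∈ Finset.univ.erase (j, k), g p = (∏ i ∈ Finset.univ.erase k, g (j, i)) *
      (∏ i, g (j + 1, i)) * ∏ i, g (j + 2, i) := by
  have h0 : (Finset.univ.erase (j, k) : Finset (Fin 3 × Fin n)) =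
      (Finset.univ.erase k).image (Prod.mk j) ∪ (Finset.univ.image (Prod.mk (j + 1)) ∪
        Finset.univ.image (Prod.mk (j + 2))) := by
    ext ⟨a, b⟩
    fin_cases j <;> fin_cases a <;> simp
  have h1 : Disjoint (Finset.univ.image (Prod.mk (j + 1)) : Finset (Fin 3 × Fin n))
      (Finset.univ.image (Prod.mk (j + 2))) := by
    rw [Finset.disjoint_left]
    rintro ⟨a, b⟩ ha hb
    fin_cases j <;> fin_cases a <;> simp at ha hb
  have h2 : Disjoint ((Finset.univ.erase k).image (Prod.mk j) : Finset (Fin 3 × Fin n))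
      (Finset.univ.image (Prod.mk (j + 1)) ∪ Finset.univ.image (Prod.mk (j + 2))) := by
    rw [Finset.disjoint_left]
    rintro ⟨a, b⟩ ha hb
    fin_cases j <;> fin_cases a <;> simp at ha hb
  have hinj : ∀ (a : Fin 3) (s : Set (Fin n)), Set.InjOn (Prod.mk a) s := fun a s =>
    (Prod.mk_right_injective a).injOn
  rw [h0, Finset.prod_union h2, Finset.prod_union h1, Finset.prod_image (hinj _ _),
    Finset.prod_image (hinj _ _), Finset.prod_image (hinj _ _), mul_assoc]

theorem hpCoeff_mul_prod {x : Fin 3 → ℝ} (hx : ∀ i j, |x i - x j| < 1) {n : ℕ} (j : Fin 3)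
    (k : Fin (n + 1)) :
    (-1) ^ (k : ℕ) * hpCoeff (x j - x (j + 1)) (x j - x (j + 2)) n k *
      ∏ p ∈ Finset.univ.erase (j, k), ((x j + (k : ℕ)) - (x p.1 + (p.2 : ℕ))) =
      (-1) ^ n * n.factorial * (x j - x (j + 1)) * (x j - x (j + 2)) := by
  have hfull : ∀ d : ℝ, ∏ i : Fin (n + 1), (d + (k : ℕ) - (i : ℕ)) =
      d * ((-1) ^ (n - k) * (shiftedPoch d k * shiftedPoch (-d) (n - k))) := by
    intro d
    rw [← Finset.mul_prod_erase _ _ (Finset.mem_univ k), prod_fin_add_sub]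
    ring
  rw [erase_prod_eq_mul]
  have e0 : ∏ i ∈ Finset.univ.erase k, ((x j + (k : ℕ)) - (x j + (i : ℕ))) =
      (-1) ^ (n - k) * ((k : ℕ).factorial * (n - k).factorial) := by
    rw [← shiftedPoch_zero_left, ← shiftedPoch_zero_left]
    have := prod_fin_add_sub 0 k
    rw [neg_zero] at this
    rw [← this]
    exact Finset.prod_congr rfl fun i _ => by ring
  have e1 : ∀ j', ∏ i : Fin (n + 1), ((x j + (k : ℕ)) - (x j' + (i : ℕ))) =
      (x j - x j') * ((-1) ^ (n - k) *
        (shiftedPoch (x j - x j') k * shiftedPoch (-(x j - x j')) (n - k))) := by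
    intro j'
    rw [← hfull]
    exact Finset.prod_congr rfl fun i _ => by ring
  rw [e0, e1, e1, hpCoeff, hpWeight, hpWeight]
  have hkn : (k : ℕ) ≤ n := by have := k.2; omega
  have hfac : (n.choose k : ℝ) * ((k : ℕ).factorial * (n - k).factorial) = n.factorial := by
    rw [← mul_assoc]; exact_mod_cast Nat.choose_mul_factorial_mul_factorial hkn
  have hne : ∀ j' m, shiftedPoch (x j - x j') m ≠ 0 := fun j' m =>
    (shiftedPoch_pos (abs_lt.1 (hx j j')).1 m).ne'
  have hne' : ∀ j' m, shiftedPoch (-(x j - x j')) m ≠ 0 := fun j' m =>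
    (shiftedPoch_pos (by linarith [(abs_lt.1 (hx j j')).2]) m).ne'
  have hs : (-1 : ℝ) ^ n = (-1) ^ (k : ℕ) * (-1) ^ (n - k) := by
    rw [← pow_add]; congr 1; omega
  have hs2 : ((-1 : ℝ) ^ (n - k)) ^ 2 = 1 := by
    rw [← pow_mul, mul_comm, pow_mul]; simp
  have a1 := hne (j + 1) k
  have a2 := hne (j + 2) k
  have b1 := hne' (j + 1) (n - k)
  have b2 := hne' (j + 2) (n - k)
  rw [← hfac, hs]
  generalize shiftedPoch (x j - x (j + 1)) k = A1 at *
  generalize shiftedPoch (x j - x (j + 2)) k = A2 at *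
  generalize shiftedPoch (-(x j - x (j + 1))) (n - k) = B1 at *
  generalize shiftedPoch (-(x j - x (j + 2))) (n - k) = B2 at *
  generalize (-1 : ℝ) ^ (n - (k : ℕ)) = ε at *
  have hε : ε ^ 3 = ε := by rw [pow_succ, hs2, one_mul]
  field_simp
  rw [show ε ^ 3 = ε from hε]

theorem coeff_eq_hpCoeff {x : Fin 3 → ℝ} (hx : ∀ i j, |x i - x j| < 1)
    {n : ℕ} {c : Fin 3 × Fin (n + 1) → ℂ}
    (hc : ∀ m < 3 * n + 2, ∑ p, c p * ((x p.1 + (p.2 : ℕ) : ℝ) : ℂ) ^ m = 0) :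
    ∃ κ : ℂ, ∀ p : Fin 3 × Fin (n + 1),
      c p * (((-1) ^ n * n.factorial * (x p.1 - x (p.1 + 1)) * (x p.1 - x (p.1 + 2)) : ℝ) : ℂ) =
        κ * (((-1) ^ (p.2 : ℕ) * hpCoeff (x p.1 - x (p.1 + 1)) (x p.1 - x (p.1 + 2)) n p.2 : ℝ) :
          ℂ) := by
  obtain ⟨κ, hκ⟩ := exists_mul_prod_sub_eq
    (v := fun p : Fin 3 × Fin (n + 1) => ((x p.1 + (p.2 : ℕ) : ℝ) : ℂ)) (c := c)
    (fun m hm => hc m (by simp at hm; omega))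
  refine ⟨κ, fun p => ?_⟩
  rw [← hpCoeff_mul_prod hx p.1 p.2, ← hκ p]
  push_cast
  ring

/-- The polynomial `(1 - X)^n q ((1 + X) / (1 - X))`, for `q` of degree at most `n`. -/
noncomputable def cayleyTransform (n : ℕ) (q : Polynomial ℂ) : Polynomial ℂ :=
  ∑ m ∈ Finset.range (n + 1),
    Polynomial.C (q.coeff m) * ((1 + Polynomial.X) ^ m * (1 - Polynomial.X) ^ (n - m))

theorem natDegree_cayleyTransform_le (n : ℕ) (q : Polynomial ℂ) :
    (cayleyTransform n q).natDegree ≤ n := by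
  refine Polynomial.natDegree_sum_le_of_forall_le _ _ fun m hm => ?_
  have hm' : m ≤ n := by rw [Finset.mem_range] at hm; omega
  refine (Polynomial.natDegree_C_mul_le _ _).trans (Polynomial.natDegree_mul_le.trans ?_)
  have h1 : ((1 + Polynomial.X : Polynomial ℂ) ^ m).natDegree ≤ m := by
    compute_degree
  have h2 : ((1 - Polynomial.X : Polynomial ℂ) ^ (n - m)).natDegree ≤ n - m := by
    compute_degree
  omega

theorem eval_cayleyTransform {n : ℕ} {q : Polynomial ℂ} (hq : q.natDegree ≤ n) {t : ℂ}
    (ht : 1 - t ≠ 0) :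
    (cayleyTransform n q).eval t = (1 - t) ^ n * q.eval ((1 + t) / (1 - t)) := by
  rw [cayleyTransform, Polynomial.eval_finsetSum, Polynomial.eval_eq_sum_range' (by omega : _ < n + 1),
    Finset.mul_sum]
  refine Finset.sum_congr rfl fun m hm => ?_
  have hm' : m ≤ n := by rw [Finset.mem_range] at hm; omega
  have : (1 - t) ^ n = (1 - t) ^ m * (1 - t) ^ (n - m) := by rw [← pow_add]; congr 1; omega
  simp only [Polynomial.eval_mul, Polynomial.eval_C, Polynomial.eval_pow, Polynomial.eval_add,
    Polynomial.eval_sub, Polynomial.eval_one, Polynomial.eval_X]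
  rw [this, div_pow]
  field_simp

theorem eval_eq_cayleyTransform {n : ℕ} {q : Polynomial ℂ} (hq : q.natDegree ≤ n) {z : ℂ}
    (hz : z + 1 ≠ 0) :
    q.eval z = ((z + 1) / 2) ^ n * (cayleyTransform n q).eval ((z - 1) / (z + 1)) := by
  have h1 : 1 - (z - 1) / (z + 1) = 2 / (z + 1) := by field_simp; ring
  have h2 : (1 + (z - 1) / (z + 1)) / (1 - (z - 1) / (z + 1)) = z := by
    rw [h1]; field_simp; ring
  rw [eval_cayleyTransform hq (by rw [h1]; exact div_ne_zero two_ne_zero hz), h2, h1, ← mul_assoc,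
    ← mul_pow]
  have : (z + 1) / 2 * (2 / (z + 1)) = 1 := by field_simp
  rw [this, one_pow, one_mul]

theorem polynomial_eq_of_eval_eq {p q : Polynomial ℂ} (a : ℂ)
    (h : ∀ z, z + a ≠ 0 → p.eval z = q.eval z) : p = q := by
  refine Polynomial.eq_of_infinite_eval_eq p q (Set.Infinite.mono (s := {-a}ᶜ) ?_ ?_)
  · intro z hz
    exact h z fun h0 => hz (eq_neg_of_add_eq_zero_left h0)
  · exact (Set.finite_singleton _).infinite_compl

theorem eq_zero_of_cayleyTransform_eq_zero {n : ℕ} {q : Polynomial ℂ} (hq : q.natDegree ≤ n)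
    (h : cayleyTransform n q = 0) : q = 0 := by
  refine polynomial_eq_of_eval_eq 1 fun z hz => ?_
  rw [eval_eq_cayleyTransform hq hz, h]
  simp

theorem moments_cayleyTransform_eq_zero {α : ℝ} {f : ℂ → ℂ}
    (hf : ∀ x : ℝ, 1 < x → f x = Complex.exp (α * Real.log ((x - 1) / (x + 1)) : ℝ))
    {n : ℕ} {q : Fin 3 → Polynomial ℂ} (hdeg : ∀ j, (q j).natDegree ≤ n) {C R' : ℝ}
    (hq : ∀ z : ℂ, R' < ‖z‖ → ‖z ^ (2 * n + 2) *
      ((q 0).eval z + (q 1).eval z * f z + (q 2).eval z * (f z) ^ 2)‖ ≤ C) :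
    ∀ m < 3 * n + 2, ∑ p : Fin 3 × Fin (n + 1), (cayleyTransform n (q p.1)).coeff p.2 *
      (((p.1 : ℕ) * α + (p.2 : ℕ) : ℝ) : ℂ) ^ m = 0 := by
  have key := moments_eq_zero Finset.univ
    (fun p : Fin 3 × Fin (n + 1) => (cayleyTransform n (q p.1)).coeff p.2)
    (fun p => -((p.1 : ℕ) * α + (p.2 : ℕ) : ℝ)) (3 * n + 2) (C := C) (δ := (|R'| + 1)⁻¹)
    (by positivity) ?_
  · intro m hm
    have h1 : (-1 : ℂ) ^ m * (-1) ^ m = 1 := by rw [← mul_pow]; simp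
    refine Eq.trans ?_ (mul_eq_zero_of_right ((-1 : ℂ) ^ m) (key m hm))
    rw [Finset.mul_sum]
    refine Finset.sum_congr rfl fun p _ => ?_
    rw [Complex.ofReal_neg]
    generalize (((p.1 : ℕ) * α + (p.2 : ℕ) : ℝ) : ℂ) = L
    rw [neg_pow L m]
    linear_combination (-(cayleyTransform n (q p.1)).coeff p.2 * L ^ m) * h1
  intro u hu hu'
  set t : ℝ := Real.exp (-u) with ht
  have ht0 : 0 < t := Real.exp_pos _
  have ht1 : t < 1 := by rw [ht, Real.exp_lt_one_iff]; linarith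
  have htu : 1 - t ≤ u := by
    have := Real.add_one_le_exp (-u)
    linarith
  have h1t : 0 < 1 - t := by linarith
  set z : ℝ := (1 + t) / (1 - t) with hz
  have hzu : u⁻¹ ≤ z := by
    rw [hz, inv_eq_one_div, div_le_div_iff₀ hu h1t]
    nlinarith
  have hz1 : 1 < z := by rw [hz, one_lt_div h1t]; linarith
  have hzt : (z - 1) / (z + 1) = t := by
    rw [hz]; field_simp; ring
  have hfz : f z = Complex.exp (-(α * u : ℝ)) := by
    rw [hf z hz1, hzt, ht, Real.log_exp]
    push_cast
    ring_nf
  have hR : R' < ‖(z : ℂ)‖ := by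
    rw [Complex.norm_real, Real.norm_eq_abs, abs_of_pos (by linarith)]
    have : |R'| + 1 < u⁻¹ := by
      rw [lt_inv_comm₀ (by positivity) hu]; exact hu'
    linarith [le_abs_self R']
  have hb := hq z hR
  have h1t' : (1 - (t : ℂ)) ≠ 0 := by exact_mod_cast h1t.ne'
  have hzc : (z : ℂ) = (1 + t) / (1 - t) := by rw [hz]; push_cast; ring
  have hexp : ∀ k : ℕ, Complex.exp (-(k * u : ℝ)) = (t : ℂ) ^ k := by
    intro k
    rw [ht, Complex.ofReal_exp, ← Complex.exp_nat_mul]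
    push_cast
    ring_nf
  have hS : ∑ p : Fin 3 × Fin (n + 1), (cayleyTransform n (q p.1)).coeff p.2 *
      Complex.exp (((-((p.1 : ℕ) * α + (p.2 : ℕ) : ℝ) : ℝ) : ℂ) * u) =
      (1 - t) ^ n * ((q 0).eval (z : ℂ) + (q 1).eval (z : ℂ) * f z +
        (q 2).eval (z : ℂ) * (f z) ^ 2) := by
    have hj : ∀ j : Fin 3, ∑ k : Fin (n + 1), (cayleyTransform n (q j)).coeff k *
        Complex.exp (((-((j : ℕ) * α + (k : ℕ) : ℝ) : ℝ) : ℂ) * u) =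
        (1 - t) ^ n * ((q j).eval (z : ℂ) * f z ^ (j : ℕ)) := by
      intro j
      rw [← mul_assoc, hzc, ← eval_cayleyTransform (hdeg j) h1t',
        Polynomial.eval_eq_sum_range' (Nat.lt_succ_of_le (natDegree_cayleyTransform_le n (q j))),
        Finset.sum_mul, ← Fin.sum_univ_eq_sum_range
          (fun k => (cayleyTransform n (q j)).coeff k * (t : ℂ) ^ k * f ((1 + t) / (1 - t)) ^ (j : ℕ))]
      refine Finset.sum_congr rfl fun k _ => ?_
      rw [← hzc, hfz, mul_assoc, ← hexp, ← Complex.exp_nat_mul, ← Complex.exp_add]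
      congr 2
      push_cast
      ring
    rw [Fintype.sum_prod_type, Fin.sum_univ_three, hj, hj, hj]
    simp
    ring
  rw [hS, norm_mul]
  rw [norm_mul, norm_pow, Complex.norm_real, Real.norm_eq_abs, abs_of_pos (by linarith)] at hb
  have hn1 : ‖(1 - (t : ℂ)) ^ n‖ ≤ u ^ n := by
    rw [norm_pow]
    have : ‖(1 - (t : ℂ))‖ = 1 - t := by
      rw [← Complex.ofReal_one, ← Complex.ofReal_sub, Complex.norm_real, Real.norm_eq_abs,
        abs_of_pos h1t]
    rw [this]
    gcongr
  set X := ‖(q 0).eval (z : ℂ) + (q 1).eval (z : ℂ) * f z + (q 2).eval (z : ℂ) * (f z) ^ 2‖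
  have hX : X ≤ C * u ^ (2 * n + 2) := by
    have h1 : (u⁻¹) ^ (2 * n + 2) * X ≤ C :=
      (mul_le_mul_of_nonneg_right (pow_le_pow_left₀ (by positivity) hzu _) (norm_nonneg _)).trans hb
    rw [inv_pow, inv_mul_le_iff₀ (by positivity)] at h1
    linarith
  calc _ ≤ u ^ n * (C * u ^ (2 * n + 2)) := by gcongr
    _ = C * u ^ (3 * n + 2) := by ring

theorem cayleyTransform_eq_hpCoeff {α : ℝ} (hα0 : 0 < α) (hα1 : α < 1 / 2) {f : ℂ → ℂ}
    (hf : ∀ x : ℝ, 1 < x → f x = Complex.exp (α * Real.log ((x - 1) / (x + 1)) : ℝ))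
    {n : ℕ} {q : Fin 3 → Polynomial ℂ} (hne : ¬∀ j, q j = 0) (hdeg : ∀ j, (q j).natDegree ≤ n)
    {C R' : ℝ} (hq : ∀ z : ℂ, R' < ‖z‖ → ‖z ^ (2 * n + 2) *
      ((q 0).eval z + (q 1).eval z * f z + (q 2).eval z * (f z) ^ 2)‖ ≤ C) (j : Fin 3) :
    ∃ d e : ℝ, |d| < 1 ∧ |e| < 1 ∧ d = (j : ℕ) * α - ((j + 1 : Fin 3) : ℕ) * α ∧
      e = (j : ℕ) * α - ((j + 2 : Fin 3) : ℕ) * α ∧ ∃ κ : ℂ, κ ≠ 0 ∧ ∀ t : ℂ,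
        (cayleyTransform n (q j)).eval t =
          κ * ∑ k ∈ Finset.range (n + 1), (hpCoeff d e n k : ℂ) * (-t) ^ k := by
  set x : Fin 3 → ℝ := fun j => (j : ℕ) * α with hx
  have hx1 : ∀ i j, |x i - x j| < 1 := by
    intro i j
    rw [abs_lt]
    fin_cases i <;> fin_cases j <;> simp [hx] <;> (try constructor) <;> linarith
  have hx0 : ∀ j, x j - x (j + 1) ≠ 0 ∧ x j - x (j + 2) ≠ 0 := by
    intro j
    fin_cases j <;> refine ⟨?_, ?_⟩ <;> simp [hx] <;> intro h <;> linarith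
  obtain ⟨κ, hκ⟩ := coeff_eq_hpCoeff hx1 (n := n)
    (c := fun p => (cayleyTransform n (q p.1)).coeff p.2)
    (moments_cayleyTransform_eq_zero hf hdeg hq)
  set A : Fin 3 → ℂ := fun j =>
    (((-1) ^ n * n.factorial * (x j - x (j + 1)) * (x j - x (j + 2)) : ℝ) : ℂ) with hA
  have hA0 : ∀ j, A j ≠ 0 := by
    intro j
    rw [hA]
    exact Complex.ofReal_ne_zero.2 (mul_ne_zero (mul_ne_zero (mul_ne_zero
      (pow_ne_zero _ (by norm_num)) (by exact_mod_cast n.factorial_ne_zero)) (hx0 j).1) (hx0 j).2)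
  have hκ0 : κ ≠ 0 := by
    rintro rfl
    refine hne fun j => eq_zero_of_cayleyTransform_eq_zero (hdeg j) ?_
    ext k
    rw [Polynomial.coeff_zero]
    rcases lt_or_ge n k with hk | hk
    · exact Polynomial.coeff_eq_zero_of_natDegree_lt
        ((natDegree_cayleyTransform_le n (q j)).trans_lt hk)
    · have := hκ (j, ⟨k, by omega⟩)
      rw [zero_mul] at this
      exact (mul_eq_zero.1 this).resolve_right (hA0 j)
  refine ⟨x j - x (j + 1), x j - x (j + 2), hx1 _ _, hx1 _ _, rfl, rfl, κ / A j,
    div_ne_zero hκ0 (hA0 j), fun t => ?_⟩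
  rw [Polynomial.eval_eq_sum_range' (Nat.lt_succ_of_le (natDegree_cayleyTransform_le n (q j))),
    Finset.mul_sum]
  refine Finset.sum_congr rfl fun k hk => ?_
  have := hκ (j, ⟨k, Finset.mem_range.1 hk⟩)
  rw [← eq_div_iff (hA0 j)] at this
  simp only at this
  rw [this]
  push_cast
  rw [neg_pow t]
  ring

theorem exists_factor_hpCoeff {d e : ℝ} (hd : |d| < 1) (he : |e| < 1) (n : ℕ) :
    ∃ T : Multiset ℝ, T.card = n ∧ (∀ t ∈ T, 0 < t) ∧ ∀ z : ℂ,
      ∑ k ∈ Finset.range (n + 1), (hpCoeff d e n k : ℂ) * z ^ k =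
        (hpCoeff d e n n : ℂ) * (T.map fun t : ℝ => z + (t : ℂ)).prod := by
  set p : Polynomial ℂ := ∑ k ∈ Finset.range (n + 1),
    Polynomial.C (hpCoeff d e n k : ℂ) * Polynomial.X ^ k with hp
  have hco : p.coeff n = hpCoeff d e n n := by
    simp [hp, Polynomial.finsetSum_coeff, Polynomial.coeff_X_pow]
  have hcn : p.coeff n ≠ 0 := by
    rw [hco]; exact Complex.ofReal_ne_zero.2 (hpCoeff_pos hd he le_rfl).ne'
  have hdeg : p.natDegree = n := by
    refine le_antisymm ?_ (Polynomial.le_natDegree_of_ne_zero hcn)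
    refine Polynomial.natDegree_sum_le_of_forall_le _ _ fun k hk => ?_
    exact (Polynomial.natDegree_C_mul_X_pow_le _ _).trans (by rw [Finset.mem_range] at hk; omega)
  have heval : ∀ z, p.eval z = ∑ k ∈ Finset.range (n + 1), (hpCoeff d e n k : ℂ) * z ^ k := by
    intro z
    simp [hp, Polynomial.eval_finsetSum]
  have hsp : p.Splits := IsAlgClosed.splits p
  have hp0 : p ≠ 0 := fun h => hcn (by rw [h, Polynomial.coeff_zero])
  have hcard : p.roots.card = n := by rw [← hsp.natDegree_eq_card_roots, hdeg]
  have hroot : ∀ z ∈ p.roots, z.im = 0 ∧ z.re < 0 := by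
    intro z hz
    have hz0 : p.eval z = 0 := (Polynomial.mem_roots hp0).1 hz
    have hn : 0 < n := by rw [← hcard]; exact Multiset.card_pos_iff_exists_mem.2 ⟨z, hz⟩
    rw [heval] at hz0
    have him : z.im = 0 := by
      by_contra h
      exact realRooted_hpCoeff hd he hn z h hz0
    refine ⟨him, ?_⟩
    by_contra! hre
    have hzr : z = (z.re : ℂ) := Complex.ext rfl (by simp [him])
    rw [hzr] at hz0
    have : ∑ k ∈ Finset.range (n + 1), hpCoeff d e n k * z.re ^ k = 0 := by exact_mod_cast hz0
    have hpos : ∀ k ∈ Finset.range (n + 1), 0 ≤ hpCoeff d e n k * z.re ^ k := fun k hk =>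
      mul_nonneg (hpCoeff_pos hd he (by rw [Finset.mem_range] at hk; omega)).le (by positivity)
    have h0 := (Finset.sum_eq_zero_iff_of_nonneg hpos).1 this 0 (by simp)
    simp [(hpCoeff_pos hd he (Nat.zero_le n)).ne'] at h0
  refine ⟨p.roots.map fun z => -z.re, by rw [Multiset.card_map, hcard], ?_, fun z => ?_⟩
  · intro t ht
    obtain ⟨z, hz, rfl⟩ := Multiset.mem_map.1 ht
    linarith [(hroot z hz).2]
  · rw [← heval, hsp.eval_eq_prod_roots, Polynomial.leadingCoeff, hdeg, hco, Multiset.map_map]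
    congr 2
    refine Multiset.map_congr rfl fun w hw => ?_
    have hzr : w = (w.re : ℂ) := Complex.ext rfl (by simp [(hroot w hw).1])
    simp only [Function.comp, Complex.ofReal_neg]
    rw [← hzr]
    ring

theorem roots_prod_one_sub_C_mul_X (W : Multiset ℝ) (φ : ℂ → ℝ) :
    (W.map fun w : ℝ => (1 - Polynomial.C (w : ℂ) * Polynomial.X : Polynomial ℂ)).prod ≠ 0 ∧
    (((W.map fun w : ℝ => (1 - Polynomial.C (w : ℂ) * Polynomial.X : Polynomial ℂ)).prod.roots).map
      φ).sum = (W.map fun w : ℝ => if w = 0 then 0 else φ ((w⁻¹ : ℝ) : ℂ)).sum := by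
  induction W using Multiset.induction_on with
  | empty => simp
  | cons w W ih =>
    have hne : (1 - Polynomial.C (w : ℂ) * Polynomial.X : Polynomial ℂ) ≠ 0 := by
      intro h
      have := congrArg (Polynomial.eval 0) h
      simp at this
    rw [Multiset.map_cons, Multiset.prod_cons]
    refine ⟨mul_ne_zero hne ih.1, ?_⟩
    rw [Polynomial.roots_mul (mul_ne_zero hne ih.1), Multiset.map_add, Multiset.sum_add, ih.2,
      Multiset.map_cons, Multiset.sum_cons]
    congr 1
    by_cases hw : w = 0
    · simp [hw]
    · have e : (1 - Polynomial.C (w : ℂ) * Polynomial.X : Polynomial ℂ) =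
          Polynomial.C (-w : ℂ) * Polynomial.X + Polynomial.C 1 := by
        simp; ring
      rw [e, Polynomial.roots_C_mul_X_add_C _ (by simpa using hw)]
      simp [hw, inv_neg]

theorem eq_prod_of_cayleyTransform {d e : ℝ} {n : ℕ} {q : Polynomial ℂ} (hq : q.natDegree ≤ n)
    (hd : |d| < 1) (he : |e| < 1) {κ : ℂ} (hκ : κ ≠ 0)
    (h : ∀ t : ℂ, (cayleyTransform n q).eval t =
      κ * ∑ k ∈ Finset.range (n + 1), (hpCoeff d e n k : ℂ) * (-t) ^ k)
    {T : Multiset ℝ} (hT : T.card = n) (hT0 : ∀ t ∈ T, 0 < t)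
    (hprod : ∀ z : ℂ, ∑ k ∈ Finset.range (n + 1), (hpCoeff d e n k : ℂ) * z ^ k =
        (hpCoeff d e n n : ℂ) * (T.map fun t : ℝ => z + (t : ℂ)).prod) :
    ∃ c : ℂ, c ≠ 0 ∧ q = Polynomial.C c * ((T.map fun t => (1 - t) / (1 + t)).map
      fun w : ℝ => (1 - Polynomial.C (w : ℂ) * Polynomial.X : Polynomial ℂ)).prod := by
  refine ⟨κ * hpCoeff d e n n / 2 ^ n * (T.map fun t : ℝ => 1 + (t : ℂ)).prod, ?_, ?_⟩
  · refine mul_ne_zero (div_ne_zero (mul_ne_zero hκ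
      (Complex.ofReal_ne_zero.2 (hpCoeff_pos hd he le_rfl).ne')) (by simp)) ?_
    intro h0
    obtain ⟨t, ht, h1⟩ := Multiset.mem_map.1 (Multiset.prod_eq_zero_iff.1 h0)
    have : (1 + t : ℝ) = 0 := by exact_mod_cast h1
    linarith [hT0 t ht]
  · refine polynomial_eq_of_eval_eq 1 fun z hz => ?_
    have hz1 : (z + 1) ^ n = (T.map fun _ => z + 1).prod := by simp [hT]
    rw [eval_eq_cayleyTransform hq hz, h, hprod, div_pow, hz1, Polynomial.eval_mul,
      Polynomial.eval_C, Polynomial.eval_multiset_prod, Multiset.map_map, Multiset.map_map]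
    have hmain : (T.map fun _ => z + 1).prod *
        (T.map fun t : ℝ => -((z - 1) / (z + 1)) + (t : ℂ)).prod =
        (T.map fun t : ℝ => 1 + (t : ℂ)).prod * (T.map ((Polynomial.eval z ∘
          fun w : ℝ => (1 - Polynomial.C (w : ℂ) * Polynomial.X : Polynomial ℂ)) ∘
            fun t => (1 - t) / (1 + t))).prod := by
      rw [← Multiset.prod_map_mul, ← Multiset.prod_map_mul]
      congr 1
      refine Multiset.map_congr rfl fun t ht => ?_
      have ht1 : (1 + t : ℂ) ≠ 0 := by
        have : (1 + t : ℝ) ≠ 0 := by linarith [hT0 t ht]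
        exact_mod_cast this
      simp
      field_simp
      ring
    linear_combination (κ * hpCoeff d e n n / 2 ^ n) * hmain

theorem integral_zeroCountingMeasure (n : ℕ) (Q : Polynomial ℂ)
    (φ : BoundedContinuousFunction ℂ ℝ) :
    ∫ z, φ z ∂(zeroCountingMeasure n Q) = (n : ℝ)⁻¹ * (Q.roots.map φ).sum := by
  have key : ∀ s : Multiset ℂ, Integrable φ (s.map Measure.dirac).sum ∧
      ∫ z, φ z ∂(s.map Measure.dirac).sum = (s.map φ).sum := by
    intro s
    induction s using Multiset.induction_on with
    | empty => simp
    | cons a s ih =>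
      rw [Multiset.map_cons, Multiset.sum_cons, Multiset.map_cons, Multiset.sum_cons]
      have ha : Integrable φ (Measure.dirac a) := φ.integrable _
      exact ⟨ha.add_measure ih.1, by rw [integral_add_measure ha ih.1, ih.2, integral_dirac]⟩
  rw [zeroCountingMeasure, integral_smul_measure, (key _).2]
  simp

theorem log_prod_one_sub {T : Multiset ℝ} (hT0 : ∀ t ∈ T, 0 < t) {y : ℝ} (hy0 : -1 < y)
    (hy1 : y < 1) :
    ((T.map fun t => (1 - t) / (1 + t)).map fun w => Real.log (1 - y * w)).sum =
      Real.log (T.map fun t => (1 - y) / (1 + y) + t).prod - Real.log (T.map fun t => 1 + t).prod +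
        T.card * -Real.log ((1 + (1 - y) / (1 + y)) / 2) := by
  have hs : 0 < (1 - y) / (1 + y) := div_pos (by linarith) (by linarith)
  induction T using Multiset.induction_on with
  | empty => simp
  | cons t T ih =>
    have ht : 0 < t := hT0 t (by simp)
    have ih := ih fun t ht => hT0 t (by simp [ht])
    have hpos : ∀ a : ℝ, 0 < a → (T.map fun t => a + t).prod ≠ 0 := by
      intro a ha h0
      obtain ⟨b, hb, h1⟩ := Multiset.mem_map.1 (Multiset.prod_eq_zero_iff.1 h0)
      linarith [hT0 b (by simp [hb])]
    simp only [Multiset.map_cons, Multiset.sum_cons, Multiset.prod_cons, Multiset.card_cons]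
    rw [ih, Real.log_mul (by positivity) (hpos _ hs), Real.log_mul (by positivity) (hpos 1 one_pos)]
    have e : 1 - y * ((1 - t) / (1 + t)) =
        ((1 - y) / (1 + y) + t) / (1 + t) / ((1 + (1 - y) / (1 + y)) / 2) := by
      have : 1 + y ≠ 0 := by linarith
      field_simp
      ring
    rw [e, Real.log_div (by positivity) (by positivity), Real.log_div (by positivity) (by positivity)]
    push_cast
    ring

theorem abs_one_sub_div_one_add_lt {t : ℝ} (ht : 0 < t) : |(1 - t) / (1 + t)| < 1 := by
  rw [abs_div, abs_of_pos (show 0 < 1 + t by linarith), div_lt_one (by linarith), abs_lt]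
  constructor <;> linarith

theorem tendsto_mean_log {d e : ℝ} (hd : |d| < 1) (he : |e| < 1) {T : ℕ → Multiset ℝ}
    (hT : ∀ n, (T n).card = n) (hT0 : ∀ n, ∀ t ∈ T n, 0 < t)
    (hprod : ∀ n, ∀ z : ℂ, ∑ k ∈ Finset.range (n + 1), (hpCoeff d e n k : ℂ) * z ^ k =
        (hpCoeff d e n n : ℂ) * ((T n).map fun t : ℝ => z + (t : ℂ)).prod)
    {y : ℝ} (hy0 : -1 < y) (hy1 : y < 1) :
    MeanTendsto (fun n => (T n).map fun t => (1 - t) / (1 + t))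
      (cubeRootMeasure.map fun τ => (1 - τ ^ 3) / (1 + τ ^ 3)) fun w => Real.log (1 - y * w) := by
  set s : ℝ := (1 - y) / (1 + y) with hs
  have hs0 : 0 < s := div_pos (by linarith) (by linarith)
  set σ : ℝ := s ^ ((1 : ℝ) / 3) with hσ
  have hσ0 : 0 < σ := Real.rpow_pos_of_pos hs0 _
  have hσ3 : σ ^ 3 = s := by
    rw [hσ, ← Real.rpow_natCast, ← Real.rpow_mul hs0.le]
    norm_num
  have hprodR : ∀ n, ∀ x : ℝ, ∑ k ∈ Finset.range (n + 1), hpCoeff d e n k * x ^ k =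
      hpCoeff d e n n * ((T n).map fun t : ℝ => x + t).prod := by
    intro n x
    have h := hprod n x
    have : (((T n).map fun t : ℝ => x + t).prod : ℂ) =
        ((T n).map fun t : ℝ => (x : ℂ) + (t : ℂ)).prod := by
      rw [← Complex.ofRealHom_eq_coe, map_multiset_prod, Multiset.map_map]
      simp
    rw [← this] at h
    exact_mod_cast h
  have hm : Measurable fun τ : ℝ => (1 - τ ^ 3) / (1 + τ ^ 3) := by fun_prop
  have hlm : Measurable fun w : ℝ => Real.log (1 - y * w) := by fun_prop
  have hpt : ∀ᵐ τ ∂cubeRootMeasure, Real.log ((σ ^ 3 + τ ^ 3) / (1 + τ ^ 3)) -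
      Real.log ((1 + s) / 2) = Real.log (1 - y * ((1 - τ ^ 3) / (1 + τ ^ 3))) := by
    filter_upwards [ae_pos_cubeRootMeasure] with τ hτ
    have hτ3 : 0 < τ ^ 3 := by positivity
    rw [hσ3, ← Real.log_div (by positivity) (by positivity)]
    congr 1
    have : 1 + y ≠ 0 := by linarith
    rw [hs]
    field_simp
    ring
  refine ⟨?_, ?_⟩
  · rw [integrable_map_measure hlm.aestronglyMeasurable hm.aemeasurable]
    exact ((integrable_log_cube_ratio hσ0).sub (integrable_const (Real.log ((1 + s) / 2)))).congr
      hpt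
  · rw [integral_map hm.aemeasurable hlm.aestronglyMeasurable, ← integral_congr_ae hpt,
      integral_sub (integrable_log_cube_ratio hσ0) (integrable_const _),
      integral_log_cube_ratio hσ0]
    have hlim := (tendsto_log_hp hd he hσ0).sub_const (Real.log ((1 + s) / 2))
    have hc : ∫ _, Real.log ((1 + s) / 2) ∂cubeRootMeasure = Real.log ((1 + s) / 2) := by simp
    rw [hc]
    refine hlim.congr' ?_
    filter_upwards [Filter.eventually_gt_atTop 0] with n hn
    have hn0 : (n : ℝ) ≠ 0 := by positivity
    have hl := (hpCoeff_pos hd he (le_refl n)).ne'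
    have hpos : ∀ a : ℝ, 0 < a → ((T n).map fun t => a + t).prod ≠ 0 := by
      intro a ha h0
      obtain ⟨b, hb, h1⟩ := Multiset.mem_map.1 (Multiset.prod_eq_zero_iff.1 h0)
      linarith [hT0 n b hb]
    have h1 := hprodR n 1
    simp only [one_pow, mul_one] at h1
    rw [log_prod_one_sub (hT0 n) hy0 hy1, hσ3, hprodR, h1, Real.log_mul hl (hpos s hs0),
      Real.log_mul hl (hpos 1 one_pos), hT n, ← hs]
    field_simp
    ring

/-- For `f(z) = ((z−1)/(z+1))^α` with `α ∈ (0, 1/2)` and Hermite–Padé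
polynomials `Q_{n,j}` of order `n` for `(1, f, f²)`, the normalized zero-counting measures
`(1/n) ∑_{ζ : Q_{n,j}(ζ)=0} δ_ζ` converge weakly (tested against bounded continuous
functions) to the probability measure on `ℝ \ [−1,1]` with density `limitDensity`. -/
theorem stmt_14
    (α : ℝ) (hα0 : 0 < α) (hα1 : α < 1 / 2)
    (f : ℂ → ℂ)
    (hf : DifferentiableOn ℂ f {z : ℂ | ¬(z.im = 0 ∧ -1 ≤ z.re ∧ z.re ≤ 1)})
    (hf1 : Filter.Tendsto f (Bornology.cobounded ℂ) (nhds 1))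
    (hbranch : ∀ z : ℂ, ¬(z.im = 0 ∧ -1 ≤ z.re ∧ z.re ≤ 1) →
      (z ^ 2 - 1) * deriv f z = 2 * (α : ℂ) * f z)
    (Q : ℕ → Fin 3 → Polynomial ℂ)
    (hQ : ∀ n : ℕ, (¬ ∀ j, Q n j = 0) ∧ (∀ j, (Q n j).natDegree ≤ n) ∧
      ∃ C R' : ℝ, ∀ z : ℂ, R' < ‖z‖ →
        ‖z ^ (2 * n + 2) *
          ((Q n 0).eval z + (Q n 1).eval z * f z + (Q n 2).eval z * (f z) ^ 2)‖ ≤ C)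
    (j : Fin 3) (φ : BoundedContinuousFunction ℂ ℝ) :
    Filter.Tendsto
      (fun n : ℕ => ∫ z, φ z ∂(zeroCountingMeasure n (Q n j)))
      Filter.atTop
      (nhds (∫ x in {x : ℝ | 1 < |x|}, φ (x : ℂ) * limitDensity x)) := by
  have hfx : ∀ x : ℝ, 1 < x → f x = Complex.exp (α * Real.log ((x - 1) / (x + 1)) : ℝ) :=
    fun x hx => branch_eq_rpow hf hf1 hbranch hx
  set d : ℝ := (j : ℕ) * α - ((j + 1 : Fin 3) : ℕ) * α with hd_def
  set e : ℝ := (j : ℕ) * α - ((j + 2 : Fin 3) : ℕ) * α with he_def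
  have hform : ∀ n, |d| < 1 ∧ |e| < 1 ∧ ∃ κ : ℂ, κ ≠ 0 ∧ ∀ t : ℂ,
      (cayleyTransform n (Q n j)).eval t =
        κ * ∑ k ∈ Finset.range (n + 1), (hpCoeff d e n k : ℂ) * (-t) ^ k := by
    intro n
    obtain ⟨hne, hdeg, C, R', hb⟩ := hQ n
    obtain ⟨d', e', h1, h2, rfl, rfl, h3⟩ := cayleyTransform_eq_hpCoeff hα0 hα1 hfx hne hdeg hb j
    exact ⟨h1, h2, h3⟩
  have hd := (hform 0).1
  have he := (hform 0).2.1
  choose T hT hT0 hprod using exists_factor_hpCoeff hd he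
  set g : ℝ → ℝ := fun w => if w = 0 then 0 else φ ((w⁻¹ : ℝ) : ℂ) with hg
  have hgc : ContinuousOn g {0}ᶜ := by
    have h1 : ContinuousOn (fun w : ℝ => φ ((w⁻¹ : ℝ) : ℂ)) {0}ᶜ :=
      (φ.continuous.comp Complex.continuous_ofReal).comp_continuousOn continuousOn_inv₀
    exact h1.congr fun w hw => if_neg hw
  have hgm : Measurable g := by
    refine Measurable.ite (measurableSet_singleton 0) measurable_const ?_
    exact φ.continuous.measurable.comp (Complex.measurable_ofReal.comp measurable_inv)
  have hgB : ∀ w, |g w| ≤ ‖φ‖ := by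
    intro w
    simp only [hg]
    split_ifs
    · simp
    · exact φ.norm_coe_le_norm _
  have hw : Measurable fun τ : ℝ => (1 - τ ^ 3) / (1 + τ ^ 3) := by fun_prop
  have : IsProbabilityMeasure (cubeRootMeasure.map fun τ => (1 - τ ^ 3) / (1 + τ ^ 3)) :=
    Measure.isProbabilityMeasure_map hw.aemeasurable
  have hmean : MeanTendsto (fun n => (T n).map fun t => (1 - t) / (1 + t))
      (cubeRootMeasure.map fun τ => (1 - τ ^ 3) / (1 + τ ^ 3)) g := by
    refine MeanTendsto.of_continuousOn_compl_zero (fun n => by simp [hT]) ?_ ?_ ?_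
      (fun y hy0 hy1 => tendsto_mean_log hd he hT hT0 hprod (by linarith) hy1) hgc hgm hgB
    · intro n w hw'
      obtain ⟨t, ht, rfl⟩ := Multiset.mem_map.1 hw'
      exact (abs_one_sub_div_one_add_lt (hT0 n t ht)).le
    · refine (ae_map_iff hw.aemeasurable
        (measurableSet_le measurable_norm measurable_const)).2 ?_
      filter_upwards [ae_pos_cubeRootMeasure] with τ hτ
      exact (abs_one_sub_div_one_add_lt (by positivity)).le
    · refine (ae_map_iff hw.aemeasurable (measurableSet_singleton 0).compl).2 ?_
      filter_upwards [ae_pos_cubeRootMeasure, ae_ne_cubeRootMeasure 1] with τ hτ hτ1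
      refine div_ne_zero (fun h => hτ1 ?_) (by positivity)
      exact (pow_eq_one_iff_of_nonneg hτ.le three_ne_zero).1 (by linarith)
  have hint : ∫ x in {x : ℝ | 1 < |x|}, φ (x : ℂ) * limitDensity x =
      ∫ w, g w ∂(cubeRootMeasure.map fun τ => (1 - τ ^ 3) / (1 + τ ^ 3)) := by
    rw [integral_map hw.aemeasurable hgm.aestronglyMeasurable,
      integral_limitDensity fun x => φ (x : ℂ)]
    refine integral_congr_ae ?_
    filter_upwards [ae_pos_cubeRootMeasure, ae_ne_cubeRootMeasure 1] with τ hτ hτ1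
    have h1 : (1 - τ ^ 3) / (1 + τ ^ 3) ≠ 0 := by
      refine div_ne_zero (fun h => hτ1 ?_) (by positivity)
      exact (pow_eq_one_iff_of_nonneg hτ.le three_ne_zero).1 (by linarith)
    simp only [hg]
    rw [if_neg h1, inv_div]
  rw [hint]
  refine hmean.2.congr fun n => ?_
  obtain ⟨κ, hκ, hev⟩ := (hform n).2.2
  obtain ⟨c, hc, hq⟩ := eq_prod_of_cayleyTransform ((hQ n).2.1 j) hd he hκ hev (hT n) (hT0 n)
    (hprod n)
  rw [integral_zeroCountingMeasure, hq, Polynomial.roots_C_mul _ hc,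
    (roots_prod_one_sub_C_mul_X _ φ).2]
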